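/- Let q₁, q₂ ∈ L¹(0,π) be real-valued, let f₁, f₂ be rational Herglotz–Nevanlinna functions, and let (b_j)_{j∈ℕ} be a sequence of pairwise distinct real numbers that is bounded from above. Suppose that for each j there exist enumerations Λ₁ʲ and Λ₂ʲ of the eigenvalues of the problems P(q₁,f₁,b_j) and P(q₂,f₂,b_j) respectively, and that Λ₁ʲ(0) = Λ₂ʲ(0) for every j (equality of the lowest eigenvalues). Then q₁(x) = q₂(x) for almost every x ∈ (0,π) and f₁ = f₂. -/

import Mathlib

open MeasureTheory Set

noncomputable section

/-- A rational Herglotz–Nevanlinna function, given by its canonical data: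
`f(λ) = a·λ + c + Σ_j γ_j / (β_j − λ)` with `a ≥ 0`, `γ_j > 0` and `β_1 < … < β_n`. -/
structure RatHN where
  a : ℝ
  c : ℝ
  n : ℕ
  γ : Fin n → ℝ
  β : Fin n → ℝ
  ha : 0 ≤ a
  hγ : ∀ j, 0 < γ j
  hβ : StrictMono β

namespace RatHN

/-- The value `f(λ)` of a rational Herglotz–Nevanlinna function. -/
def eval (f : RatHN) (lam : ℝ) : ℝ :=
  f.a * lam + f.c + ∑ j : Fin f.n, f.γ j / (f.β j - lam)

/-- `lam` is a pole of `f`. -/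
def IsPole (f : RatHN) (lam : ℝ) : Prop := ∃ j, f.β j = lam

end RatHN

/-- A (Carathéodory) solution of `−y″ + Q·y = λ·y` on `[0, L]`:
a pair of continuous functions `y, y'` satisfying the two integral equations. -/
def IsCaraSol (Q : ℝ → ℝ) (L lam : ℝ) (y y' : ℝ → ℝ) : Prop :=
  ContinuousOn y (Icc 0 L) ∧ ContinuousOn y' (Icc 0 L) ∧
  (∀ x ∈ Icc (0:ℝ) L, y x = y 0 + ∫ t in (0:ℝ)..x, y' t) ∧
  (∀ x ∈ Icc (0:ℝ) L, y' x = y' 0 + ∫ t in (0:ℝ)..x, (Q t - lam) * y t)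

/-- `lam` is an eigenvalue of the problem `P(q, f, b)`, where `b : Option ℝ`
and `none` stands for the Dirichlet condition (`b = ∞`) at the right endpoint. -/
def IsEigen (q : ℝ → ℝ) (f : RatHN) (b : Option ℝ) (lam : ℝ) : Prop :=
  ∃ y y' : ℝ → ℝ, IsCaraSol q Real.pi lam y y' ∧
    (∃ x ∈ Icc (0:ℝ) Real.pi, y x ≠ 0) ∧
    (¬ f.IsPole lam → y' 0 = -f.eval lam * y 0) ∧
    (f.IsPole lam → y 0 = 0) ∧
    (∀ bb : ℝ, b = some bb → y' Real.pi = bb * y Real.pi) ∧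
    (b = none → y Real.pi = 0)

/-- The set of eigenvalues of the problem `P(q, f, b)`. -/
def eigenvalues (q : ℝ → ℝ) (f : RatHN) (b : Option ℝ) : Set ℝ :=
  {lam | IsEigen q f b lam}

/-- `Λ` is an enumeration of the set `S`: a strictly increasing sequence whose
range is exactly `S`. -/
def IsEnum (S : Set ℝ) (Λ : ℕ → ℝ) : Prop :=
  StrictMono Λ ∧ Set.range Λ = S


section Volterra

variable {E : Type*} [NormedAddCommGroup E] [NormedSpace ℂ E]

theorem zero_mem_Icc_pi : (0 : ℝ) ∈ Icc (0 : ℝ) Real.pi := ⟨le_rfl, Real.pi_pos.le⟩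

theorem pi_mem_Icc_pi : Real.pi ∈ Icc (0 : ℝ) Real.pi := ⟨Real.pi_pos.le, le_rfl⟩

/-- Pointwise multiplication by a scalar continuous function, as a bounded operator. -/
def mulOp (g : C(Icc (0 : ℝ) Real.pi, ℂ)) :
    C(Icc (0 : ℝ) Real.pi, E) →L[ℂ] C(Icc (0 : ℝ) Real.pi, E) :=
  LinearMap.mkContinuous
    { toFun := fun f => ⟨fun t => g t • f t, by fun_prop⟩
      map_add' := fun f₁ f₂ => by ext t; simp
      map_smul' := fun c f => by ext t; exact smul_comm _ _ _ } ‖g‖ (fun f => by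
    refine (ContinuousMap.norm_le _ (by positivity)).2 fun t => ?_
    simp only [LinearMap.coe_mk, AddHom.coe_mk, ContinuousMap.coe_mk, norm_smul]
    exact mul_le_mul (g.norm_coe_le_norm t) (f.norm_coe_le_norm t) (norm_nonneg _) (norm_nonneg _))

@[simp] theorem mulOp_apply (g : C(Icc (0 : ℝ) Real.pi, ℂ)) (f : C(Icc (0 : ℝ) Real.pi, E))
    (t : Icc (0 : ℝ) Real.pi) : mulOp g f t = g t • f t := rfl

/-- The integrand of the Volterra operator, extended to the real line. -/
def voltFun (A : C(Icc (0 : ℝ) Real.pi, E →L[ℂ] E)) (f : C(Icc (0 : ℝ) Real.pi, E)) (s : ℝ) : E :=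
  A (projIcc 0 Real.pi Real.pi_pos.le s) (f (projIcc 0 Real.pi Real.pi_pos.le s))

theorem continuous_voltFun (A : C(Icc (0 : ℝ) Real.pi, E →L[ℂ] E)) (f : C(Icc (0 : ℝ) Real.pi, E)) :
    Continuous (voltFun A f) := by
  unfold voltFun
  have h := continuous_projIcc (a := (0 : ℝ)) (b := Real.pi) (h := Real.pi_pos.le)
  exact (A.continuous.comp h).clm_apply (f.continuous.comp h)

theorem norm_voltFun_le (A : C(Icc (0 : ℝ) Real.pi, E →L[ℂ] E)) (f : C(Icc (0 : ℝ) Real.pi, E))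
    (s : ℝ) : ‖voltFun A f s‖ ≤ ‖A‖ * ‖f (projIcc 0 Real.pi Real.pi_pos.le s)‖ :=
  ((A _).le_opNorm _).trans (by gcongr; exact A.norm_coe_le_norm _)

/-- The Volterra operator `f ↦ ∫₀ᵗ A f`. -/
def volt (A : C(Icc (0 : ℝ) Real.pi, E →L[ℂ] E)) :
    C(Icc (0 : ℝ) Real.pi, E) →L[ℂ] C(Icc (0 : ℝ) Real.pi, E) :=
  LinearMap.mkContinuous
    { toFun := fun f => ⟨fun t => ∫ s in (0 : ℝ)..t, voltFun A f s,
        (intervalIntegral.continuous_primitive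
          (fun a b => (continuous_voltFun A f).intervalIntegrable a b) 0).comp
            continuous_subtype_val⟩
      map_add' := fun f₁ f₂ => by
        ext t
        simp only [ContinuousMap.coe_mk, ContinuousMap.add_apply]
        rw [← intervalIntegral.integral_add ((continuous_voltFun A f₁).intervalIntegrable _ _)
          ((continuous_voltFun A f₂).intervalIntegrable _ _)]
        simp [voltFun]
      map_smul' := fun c f => by
        ext t
        simp only [ContinuousMap.coe_mk, ContinuousMap.smul_apply, RingHom.id_apply]
        rw [← intervalIntegral.integral_smul]
        simp [voltFun] } (‖A‖ * Real.pi) (fun f => by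
    refine (ContinuousMap.norm_le _ (by positivity)).2 fun t => ?_
    have := intervalIntegral.norm_integral_le_of_norm_le_const (a := 0) (b := (t : ℝ))
      (f := voltFun A f) (C := ‖A‖ * ‖f‖)
      (fun s _ => (norm_voltFun_le A f s).trans (by gcongr; exact f.norm_coe_le_norm _))
    refine this.trans ?_
    rw [sub_zero, abs_of_nonneg t.2.1, mul_right_comm]
    gcongr
    exact t.2.2)

theorem volt_apply (A : C(Icc (0 : ℝ) Real.pi, E →L[ℂ] E)) (f : C(Icc (0 : ℝ) Real.pi, E))
    (t : Icc (0 : ℝ) Real.pi) : volt A f t = ∫ s in (0 : ℝ)..t, voltFun A f s := rfl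

theorem volt_add_smul (A B : C(Icc (0 : ℝ) Real.pi, E →L[ℂ] E)) (z : ℂ) :
    volt (A + z • B) = volt A + z • volt B := by
  ext f t
  simp only [add_apply, smul_apply,
    ContinuousMap.add_apply, ContinuousMap.smul_apply, volt_apply]
  rw [← intervalIntegral.integral_smul, ← intervalIntegral.integral_add
    ((continuous_voltFun A f).intervalIntegrable _ _)
    (Continuous.intervalIntegrable (by exact (continuous_voltFun B f).const_smul z) _ _)]
  simp [voltFun]

/-- The exponential weight `t ↦ e^{c t}`. -/
def expWeight (c : ℝ) : C(Icc (0 : ℝ) Real.pi, ℂ) :=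
  ⟨fun t => ((Real.exp (c * t) : ℝ) : ℂ), by fun_prop⟩

theorem mulOp_expWeight_mul_neg (c : ℝ) :
    (mulOp (expWeight c) : C(Icc (0 : ℝ) Real.pi, E) →L[ℂ] _) * mulOp (expWeight (-c)) = 1 := by
  ext f t
  simp only [mul_apply_eq_comp, mulOp_apply, expWeight, ContinuousMap.coe_mk, smul_smul,
    one_apply_eq_self]
  rw [← Complex.ofReal_mul, ← Real.exp_add]
  simp

theorem norm_conj_volt_le (A : C(Icc (0 : ℝ) Real.pi, E →L[ℂ] E)) {c : ℝ} (hc : 0 < c) :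
    ‖mulOp (expWeight (-c)) * volt A * mulOp (expWeight c)‖ ≤ ‖A‖ / c := by
  refine ContinuousLinearMap.opNorm_le_bound _ (by positivity) fun f => ?_
  refine (ContinuousMap.norm_le _ (by positivity)).2 fun t => ?_
  simp only [mul_apply_eq_comp, mulOp_apply, volt_apply, norm_smul]
  have h1 : ‖expWeight (-c) t‖ = Real.exp (-(c * t)) := by
    simp [expWeight, Complex.norm_exp]
  have h2 : ∀ s ∈ Ioc (0 : ℝ) t, ‖voltFun A (mulOp (expWeight c) f) s‖ ≤
      ‖A‖ * ‖f‖ * Real.exp (c * s) := by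
    intro s hs
    have hs' : s ∈ Icc (0 : ℝ) Real.pi := ⟨hs.1.le, hs.2.trans t.2.2⟩
    refine (norm_voltFun_le _ _ _).trans ?_
    rw [projIcc_of_mem _ hs', mulOp_apply, norm_smul]
    have h3 : ‖expWeight c ⟨s, hs'⟩‖ = Real.exp (c * s) := by
      simp [expWeight, Complex.norm_exp]
    rw [h3, mul_assoc, mul_comm (Real.exp _)]
    gcongr
    exact f.norm_coe_le_norm _
  have h4 := intervalIntegral.norm_integral_le_of_norm_le (μ := volume) t.2.1
    (Filter.Eventually.of_forall h2) (Continuous.intervalIntegrable (by fun_prop) _ _)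
  rw [h1]
  have h5 : ∫ s in (0 : ℝ)..t, ‖A‖ * ‖f‖ * Real.exp (c * s) =
      ‖A‖ * ‖f‖ * ((Real.exp (c * t) - 1) / c) := by
    rw [intervalIntegral.integral_const_mul, intervalIntegral.integral_comp_mul_left Real.exp hc.ne']
    simp [integral_exp, div_eq_inv_mul]
  rw [h5] at h4
  calc _ ≤ Real.exp (-(c * t)) * (‖A‖ * ‖f‖ * ((Real.exp (c * t) - 1) / c)) := by gcongr
    _ = ‖A‖ / c * ‖f‖ * (1 - Real.exp (-(c * t))) := by
        rw [Real.exp_neg]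
        field_simp
    _ ≤ ‖A‖ / c * ‖f‖ * 1 := by gcongr; linarith [Real.exp_pos (-(c * (t : ℝ)))]
    _ = _ := mul_one _

theorem isUnit_one_sub_volt [CompleteSpace E] (A : C(Icc (0 : ℝ) Real.pi, E →L[ℂ] E)) :
    IsUnit (1 - volt A) := by
  set c : ℝ := ‖A‖ + 1
  have hc : 0 < c := by positivity
  have h1 : ‖mulOp (expWeight (-c)) * volt A * mulOp (expWeight c)‖ < 1 :=
    (norm_conj_volt_le A hc).trans_lt ((div_lt_one hc).2 (lt_add_one _))
  have h2 := isUnit_one_sub_of_norm_lt_one (R := C(Icc (0 : ℝ) Real.pi, E) →L[ℂ] C(Icc (0 : ℝ) Real.pi, E)) h1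
  have e1 := mulOp_expWeight_mul_neg (E := E) c
  have e2 := mulOp_expWeight_mul_neg (E := E) (-c)
  rw [neg_neg] at e2
  have hu1 : IsUnit (mulOp (E := E) (expWeight c)) := ⟨⟨_, _, e1, e2⟩, rfl⟩
  have hu2 : IsUnit (mulOp (E := E) (expWeight (-c))) := ⟨⟨_, _, e2, e1⟩, rfl⟩
  have h3 : 1 - volt A = mulOp (expWeight c) *
      (1 - mulOp (expWeight (-c)) * volt A * mulOp (expWeight c)) * mulOp (expWeight (-c)) := by
    simp only [mul_sub, sub_mul, mul_one, e1]
    rw [← mul_assoc, ← mul_assoc, e1, one_mul, mul_assoc, e1, mul_one]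
  rw [h3]
  exact (hu1.mul h2).mul hu2

end Volterra

/-- The regularised first-order system attached to `−y″ + σ′ y = z y`; the second component is
the quasi-derivative `w = y′ − σ y`. -/
def IsSys (σ : ℝ → ℝ) (z : ℂ) (y w : ℝ → ℂ) : Prop :=
  ∀ t ∈ Icc (0 : ℝ) Real.pi,
    HasDerivWithinAt y (σ t * y t + w t) (Icc 0 Real.pi) t ∧
    HasDerivWithinAt w (-(σ t * w t) - (σ t ^ 2 + z) * y t) (Icc 0 Real.pi) t

namespace IsSys

variable {σ : ℝ → ℝ} {z : ℂ} {y w y₁ w₁ y₂ w₂ : ℝ → ℂ}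

theorem continuousOn_fst (h : IsSys σ z y w) : ContinuousOn y (Icc 0 Real.pi) :=
  fun t ht => (h t ht).1.continuousWithinAt

theorem continuousOn_snd (h : IsSys σ z y w) : ContinuousOn w (Icc 0 Real.pi) :=
  fun t ht => (h t ht).2.continuousWithinAt

theorem lin (h₁ : IsSys σ z y₁ w₁) (h₂ : IsSys σ z y₂ w₂) (a b : ℂ) :
    IsSys σ z (fun t => a * y₁ t + b * y₂ t) (fun t => a * w₁ t + b * w₂ t) := by
  intro t ht
  refine ⟨?_, ?_⟩
  · convert! ((h₁ t ht).1.const_mul a).add ((h₂ t ht).1.const_mul b) using 1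
    ring
  · convert! ((h₁ t ht).2.const_mul a).add ((h₂ t ht).2.const_mul b) using 1
    ring

theorem congr_sigma {τ : ℝ → ℝ} (h : IsSys σ z y w) (hτ : EqOn σ τ (Icc 0 Real.pi)) :
    IsSys τ z y w := by
  intro t ht
  rw [← hτ ht]
  exact h t ht

theorem conj (h : IsSys σ z y w) :
    IsSys σ (starRingEnd ℂ z) (fun t => starRingEnd ℂ (y t)) (fun t => starRingEnd ℂ (w t)) := by
  intro t ht
  refine ⟨?_, ?_⟩
  · convert! (Complex.conjCLE.toContinuousLinearMap.hasFDerivAt.comp_hasDerivWithinAt t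
      (h t ht).1) using 1
    simp
  · convert! (Complex.conjCLE.toContinuousLinearMap.hasFDerivAt.comp_hasDerivWithinAt t
      (h t ht).2) using 1
    simp

/-- Exponential growth bound for solutions of the system. -/
theorem norm_le (h : IsSys σ z y w) {S κ : ℝ} (hS : ∀ t ∈ Icc (0 : ℝ) Real.pi, |σ t| ≤ S)
    (hκ : 1 ≤ κ) (hz : ‖z‖ ≤ κ ^ 2) {t : ℝ} (ht : t ∈ Icc (0 : ℝ) Real.pi) :
    max (κ * ‖y t‖) ‖w t‖ ≤
      max (κ * ‖y 0‖) ‖w 0‖ * Real.exp ((S + κ + S ^ 2) * t) := by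
  have hκ0 : (0 : ℝ) < κ := by linarith
  have hnorm : ∀ a b : ℂ, ‖((κ : ℂ) * a, b)‖ = max (κ * ‖a‖) ‖b‖ := fun a b => by
    rw [Prod.norm_def, norm_mul, Complex.norm_real, Real.norm_of_nonneg hκ0.le]
  have key := norm_le_gronwallBound_of_norm_deriv_right_le
    (f := fun t => ((κ : ℂ) * y t, w t))
    (f' := fun t => ((κ : ℂ) * (σ t * y t + w t), -(σ t * w t) - (σ t ^ 2 + z) * y t))
    (a := 0) (b := Real.pi) (K := S + κ + S ^ 2) (ε := 0) (δ := max (κ * ‖y 0‖) ‖w 0‖)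
    ((continuousOn_const.mul h.continuousOn_fst).prodMk h.continuousOn_snd)
    (fun s hs => by
      have hs' : s ∈ Icc (0 : ℝ) Real.pi := ⟨hs.1, hs.2.le⟩
      have := ((h s hs').1.const_mul (κ : ℂ)).prodMk (h s hs').2
      exact this.mono_of_mem_nhdsWithin (Icc_mem_nhdsGE_of_mem hs))
    (hnorm _ _).le
    (fun s hs => by
      have hs' : s ∈ Icc (0 : ℝ) Real.pi := ⟨hs.1, hs.2.le⟩
      rw [add_zero, hnorm, hnorm]
      set N := max (κ * ‖y s‖) ‖w s‖
      have hN1 : κ * ‖y s‖ ≤ N := le_max_left _ _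
      have hN2 : ‖w s‖ ≤ N := le_max_right _ _
      have hN0 : 0 ≤ N := (norm_nonneg _).trans hN2
      have hy : ‖y s‖ ≤ N := by nlinarith [norm_nonneg (y s)]
      have hσ := hS s hs'
      have hS0 : 0 ≤ S := (abs_nonneg _).trans hσ
      have hσ2 : |σ s| ^ 2 ≤ S ^ 2 := by gcongr
      have n1 : ‖(σ s : ℂ)‖ = |σ s| := by simp
      apply max_le
      · calc κ * ‖(σ s : ℂ) * y s + w s‖ ≤ κ * (|σ s| * ‖y s‖ + ‖w s‖) := by
              gcongr
              refine (norm_add_le _ _).trans ?_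
              rw [norm_mul, n1]
          _ = |σ s| * (κ * ‖y s‖) + κ * ‖w s‖ := by ring
          _ ≤ S * N + κ * N := by gcongr
          _ ≤ (S + κ + S ^ 2) * N := by nlinarith [mul_nonneg (sq_nonneg S) hN0]
      · calc ‖-((σ s : ℂ) * w s) - ((σ s : ℂ) ^ 2 + z) * y s‖
            ≤ |σ s| * ‖w s‖ + (|σ s| ^ 2 + ‖z‖) * ‖y s‖ := by
              refine (norm_sub_le _ _).trans ?_
              rw [norm_neg, norm_mul, norm_mul, n1]
              gcongr
              refine (norm_add_le _ _).trans ?_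
              rw [norm_pow, n1]
          _ ≤ S * N + (S ^ 2 * N + κ ^ 2 * ‖y s‖) := by
              rw [add_mul]
              gcongr
          _ = S * N + S ^ 2 * N + κ * (κ * ‖y s‖) := by ring
          _ ≤ S * N + S ^ 2 * N + κ * N := by gcongr
          _ = _ := by ring) t ht
  rw [gronwallBound_ε0, sub_zero, hnorm] at key
  exact key

theorem eqOn_zero (hσ : ContinuousOn σ (Icc 0 Real.pi)) (h : IsSys σ z y w)
    (hy : y 0 = 0) (hw : w 0 = 0) {t : ℝ} (ht : t ∈ Icc (0 : ℝ) Real.pi) :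
    y t = 0 ∧ w t = 0 := by
  obtain ⟨S, hS⟩ := isCompact_Icc.exists_bound_of_continuousOn hσ
  have hκ : (1 : ℝ) ≤ 1 + ‖z‖ := by linarith [norm_nonneg z]
  have := h.norm_le (S := S) hS hκ (by nlinarith [norm_nonneg z]) ht
  rw [hy, hw] at this
  simp only [norm_zero, mul_zero, max_self, zero_mul] at this
  have h1 : (1 + ‖z‖) * ‖y t‖ ≤ 0 := (le_max_left _ _).trans this
  have h2 : ‖w t‖ ≤ 0 := (le_max_right _ _).trans this
  refine ⟨?_, norm_le_zero_iff.1 h2⟩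
  refine norm_le_zero_iff.1 ?_
  nlinarith [norm_nonneg (y t)]

theorem unique (hσ : ContinuousOn σ (Icc 0 Real.pi)) (h₁ : IsSys σ z y₁ w₁)
    (h₂ : IsSys σ z y₂ w₂) (hy : y₁ 0 = y₂ 0) (hw : w₁ 0 = w₂ 0) {t : ℝ}
    (ht : t ∈ Icc (0 : ℝ) Real.pi) : y₁ t = y₂ t ∧ w₁ t = w₂ t := by
  have := (h₁.lin h₂ 1 (-1)).eqOn_zero hσ (by simp [hy]) (by simp [hw]) ht
  exact ⟨by linear_combination this.1, by linear_combination this.2⟩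

/-- The Wronskian of two solutions is constant. -/
theorem wronskian (h₁ : IsSys σ z y₁ w₁) (h₂ : IsSys σ z y₂ w₂) {t : ℝ}
    (ht : t ∈ Icc (0 : ℝ) Real.pi) :
    y₁ t * w₂ t - w₁ t * y₂ t = y₁ 0 * w₂ 0 - w₁ 0 * y₂ 0 := by
  have hd : ∀ s ∈ Icc (0 : ℝ) Real.pi,
      HasDerivWithinAt (fun s => y₁ s * w₂ s - w₁ s * y₂ s) 0 (Icc 0 Real.pi) s := by
    intro s hs
    convert! ((h₁ s hs).1.mul (h₂ s hs).2).sub ((h₁ s hs).2.mul (h₂ s hs).1) using 1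
    ring
  exact (convex_Icc _ _).is_const_of_fderivWithin_eq_zero (𝕜 := ℝ)
    (fun s hs => (hd s hs).differentiableWithinAt)
    (fun s hs => by
      have := (hd s hs).hasFDerivWithinAt.fderivWithin
        (uniqueDiffOn_Icc Real.pi_pos s hs)
      rw [this]; ext; simp) ht zero_mem_Icc_pi

end IsSys

theorem differentiable_inverse_one_sub_add_smul {R : Type*} [NormedRing R] [NormedAlgebra ℂ R]
    [CompleteSpace R] (a b : R) (h : ∀ z : ℂ, IsUnit (1 - (a + z • b))) :
    Differentiable ℂ fun z : ℂ => Ring.inverse (1 - (a + z • b)) := by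
  intro z
  have h1 : DifferentiableAt ℂ (fun z : ℂ => 1 - (a + z • b)) z := by fun_prop
  exact (differentiableAt_inverse (𝕜 := ℂ) (h z)).comp z h1

/-- The solution of the initial value problem, entire in the spectral parameter. -/
theorem exists_isSys {σ : ℝ → ℝ} (hσ : ContinuousOn σ (Icc 0 Real.pi)) (a b : ℂ) :
    ∃ y w : ℝ → ℂ → ℂ, (∀ z, IsSys σ z (fun t => y t z) (fun t => w t z)) ∧
      (∀ z, y 0 z = a) ∧ (∀ z, w 0 z = b) ∧
      (∀ t, Differentiable ℂ (y t)) ∧ (∀ t, Differentiable ℂ (w t)) ∧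
      Continuous (fun p : ℝ × ℂ => y p.1 p.2) := by
  have hpi := Real.pi_pos.le
  have hσc : Continuous (fun t : Icc (0 : ℝ) Real.pi => (σ t : ℂ)) :=
    Complex.continuous_ofReal.comp (continuousOn_iff_continuous_domRestrict.1 hσ)
  let L1 : ℂ × ℂ →L[ℂ] ℂ × ℂ :=
    (ContinuousLinearMap.fst ℂ ℂ ℂ).prod (-ContinuousLinearMap.snd ℂ ℂ ℂ)
  let L2 : ℂ × ℂ →L[ℂ] ℂ × ℂ := (ContinuousLinearMap.snd ℂ ℂ ℂ).prod 0
  let L3 : ℂ × ℂ →L[ℂ] ℂ × ℂ :=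
    (0 : ℂ × ℂ →L[ℂ] ℂ).prod (-ContinuousLinearMap.fst ℂ ℂ ℂ)
  let A0 : C(Icc (0 : ℝ) Real.pi, ℂ × ℂ →L[ℂ] ℂ × ℂ) :=
    ⟨fun t => (σ t : ℂ) • L1 + L2 + (σ t : ℂ) ^ 2 • L3, by fun_prop⟩
  let A1 : C(Icc (0 : ℝ) Real.pi, ℂ × ℂ →L[ℂ] ℂ × ℂ) := ContinuousMap.const _ L3
  let c0 : C(Icc (0 : ℝ) Real.pi, ℂ × ℂ) := ContinuousMap.const _ (a, b)
  let Φ : ℂ → C(Icc (0 : ℝ) Real.pi, ℂ × ℂ) := fun z =>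
    Ring.inverse (1 - volt (A0 + z • A1)) c0
  have hΦd : Differentiable ℂ Φ := by
    have h1 := differentiable_inverse_one_sub_add_smul
      (R := C(Icc (0 : ℝ) Real.pi, ℂ × ℂ) →L[ℂ] C(Icc (0 : ℝ) Real.pi, ℂ × ℂ)) (volt A0) (volt A1)
      (fun z => by rw [← volt_add_smul]; exact isUnit_one_sub_volt _)
    have h2 : Differentiable ℂ fun z : ℂ => Ring.inverse (1 - (volt A0 + z • volt A1)) c0 :=
      fun z => (h1 z).clm_apply (differentiableAt_const c0)
    simpa only [Φ, volt_add_smul] using h2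
  have hΦe : ∀ z, Φ z = c0 + volt (A0 + z • A1) (Φ z) := by
    intro z
    have h1 : (1 - volt (A0 + z • A1)) * Ring.inverse (1 - volt (A0 + z • A1)) = 1 :=
      Ring.mul_inverse_cancel _ (isUnit_one_sub_volt _)
    have h2 := congrArg (fun T : C(Icc (0 : ℝ) Real.pi, ℂ × ℂ) →L[ℂ] _ => T c0) h1
    simp only [mul_apply_eq_comp, one_apply_eq_self, sub_apply] at h2
    rw [sub_eq_iff_eq_add] at h2
    exact h2
  have hder : ∀ z, ∀ t ∈ Icc (0 : ℝ) Real.pi,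
      HasDerivWithinAt (fun s => Φ z (projIcc 0 Real.pi hpi s))
        (voltFun (A0 + z • A1) (Φ z) t) (Icc 0 Real.pi) t := by
    intro z t ht
    have h1 : HasDerivAt (fun s : ℝ => (a, b) + ∫ r in (0 : ℝ)..s, voltFun (A0 + z • A1) (Φ z) r)
        (voltFun (A0 + z • A1) (Φ z) t) t := by
      have hc := continuous_voltFun (A0 + z • A1) (Φ z)
      exact (intervalIntegral.integral_hasDerivAt_right (hc.intervalIntegrable _ _)
        hc.aestronglyMeasurable.stronglyMeasurableAtFilter hc.continuousAt).const_add _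
    refine h1.hasDerivWithinAt.congr_of_mem (fun s hs => ?_) ht
    conv_lhs => rw [hΦe]
    rw [projIcc_of_mem _ hs]
    rfl
  refine ⟨fun t z => (Φ z (projIcc 0 Real.pi hpi t)).1,
    fun t z => (Φ z (projIcc 0 Real.pi hpi t)).2, ?_, ?_, ?_, ?_, ?_, ?_⟩
  · intro z t ht
    have h1 := hder z t ht
    simp only [voltFun, projIcc_of_mem hpi ht] at h1
    refine ⟨?_, ?_⟩
    · convert! (ContinuousLinearMap.fst ℝ ℂ ℂ).hasFDerivAt.comp_hasDerivWithinAt t h1 using 1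
      simp [A0, A1, L1, L2, L3, projIcc_of_mem hpi ht]
    · convert! (ContinuousLinearMap.snd ℝ ℂ ℂ).hasFDerivAt.comp_hasDerivWithinAt t h1 using 1
      simp [A0, A1, L1, L2, L3, projIcc_of_mem hpi ht]
      ring
  · intro z
    have : Φ z ⟨0, zero_mem_Icc_pi⟩ = (a, b) := by
      rw [hΦe]
      simp [volt_apply, c0]
    simp only [projIcc_of_mem hpi zero_mem_Icc_pi, this]
  · intro z
    have : Φ z ⟨0, zero_mem_Icc_pi⟩ = (a, b) := by
      rw [hΦe]
      simp [volt_apply, c0]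
    simp only [projIcc_of_mem hpi zero_mem_Icc_pi, this]
  · intro t
    exact (((ContinuousMap.evalCLM ℂ (projIcc 0 Real.pi hpi t)).differentiable).comp hΦd).fst
  · intro t
    exact (((ContinuousMap.evalCLM ℂ (projIcc 0 Real.pi hpi t)).differentiable).comp hΦd).snd
  · have h1 : Continuous (fun p : ℝ × ℂ => Φ p.2 (projIcc 0 Real.pi hpi p.1)) :=
      (hΦd.continuous.comp continuous_snd).eval (continuous_projIcc.comp continuous_fst)
    exact h1.fst

/-- The real form of the regularised system. -/
def IsSysR (σ : ℝ → ℝ) (lam : ℝ) (y w : ℝ → ℝ) : Prop :=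
  ∀ t ∈ Icc (0 : ℝ) Real.pi,
    HasDerivWithinAt y (σ t * y t + w t) (Icc 0 Real.pi) t ∧
    HasDerivWithinAt w (-(σ t * w t) - (σ t ^ 2 + lam) * y t) (Icc 0 Real.pi) t

theorem IsSysR.toIsSys {σ : ℝ → ℝ} {lam : ℝ} {y w : ℝ → ℝ} (h : IsSysR σ lam y w) :
    IsSys σ lam (fun t => (y t : ℂ)) (fun t => (w t : ℂ)) := by
  intro t ht
  refine ⟨?_, ?_⟩
  · convert! (h t ht).1.ofReal_comp using 1
    push_cast; ring
  · convert! (h t ht).2.ofReal_comp using 1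
    push_cast; ring

theorem IsSys.re {σ : ℝ → ℝ} {lam : ℝ} {y w : ℝ → ℂ} (h : IsSys σ lam y w) :
    IsSysR σ lam (fun t => (y t).re) (fun t => (w t).re) := by
  intro t ht
  refine ⟨?_, ?_⟩
  · convert! Complex.reCLM.hasFDerivAt.comp_hasDerivWithinAt t (h t ht).1 using 1
    simp
  · convert! Complex.reCLM.hasFDerivAt.comp_hasDerivWithinAt t (h t ht).2 using 1
    simp [← Complex.ofReal_pow, ← Complex.ofReal_add]

theorem IsSysR.continuousOn_fst {σ : ℝ → ℝ} {lam : ℝ} {y w : ℝ → ℝ} (h : IsSysR σ lam y w) :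
    ContinuousOn y (Icc 0 Real.pi) := fun t ht => (h t ht).1.continuousWithinAt

theorem IsSysR.continuousOn_snd {σ : ℝ → ℝ} {lam : ℝ} {y w : ℝ → ℝ} (h : IsSysR σ lam y w) :
    ContinuousOn w (Icc 0 Real.pi) := fun t ht => (h t ht).2.continuousWithinAt

theorem hasDerivWithinAt_primitive {g : ℝ → ℝ} (hg : ContinuousOn g (Icc 0 Real.pi)) {t : ℝ}
    (ht : t ∈ Icc (0 : ℝ) Real.pi) :
    HasDerivWithinAt (fun x => ∫ s in (0 : ℝ)..x, g s) (g t) (Icc 0 Real.pi) t := by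
  have : Fact (t ∈ Icc (0 : ℝ) Real.pi) := ⟨ht⟩
  refine intervalIntegral.integral_hasDerivWithinAt_right ?_
    (hg.stronglyMeasurableAtFilter_nhdsWithin measurableSet_Icc t) (hg t ht)
  refine ContinuousOn.intervalIntegrable (hg.mono ?_)
  rw [uIcc_of_le ht.1]
  exact Icc_subset_Icc le_rfl ht.2

theorem eq_add_integral_of_hasDerivWithinAt {F g : ℝ → ℝ} (hg : ContinuousOn g (Icc 0 Real.pi))
    (hF : ∀ t ∈ Icc (0 : ℝ) Real.pi, HasDerivWithinAt F (g t) (Icc 0 Real.pi) t) {x : ℝ}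
    (hx : x ∈ Icc (0 : ℝ) Real.pi) : F x = F 0 + ∫ s in (0 : ℝ)..x, g s := by
  have hsub : Icc 0 x ⊆ Icc 0 Real.pi := Icc_subset_Icc le_rfl hx.2
  have := intervalIntegral.integral_eq_sub_of_hasDerivAt_of_le hx.1
    (fun t ht => (hF t (hsub ht)).continuousWithinAt.mono hsub)
    (fun t ht => (hF t (hsub (Ioo_subset_Icc_self ht))).hasDerivAt
      (Icc_mem_nhds ht.1 (ht.2.trans_le hx.2)))
    (ContinuousOn.intervalIntegrable (hg.mono (by rwa [uIcc_of_le hx.1])))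
  linarith

theorem uIcc_subset_Icc_pi {x : ℝ} (hx : x ∈ Icc (0 : ℝ) Real.pi) :
    uIcc 0 x ⊆ Icc 0 Real.pi := by
  rw [uIcc_of_le hx.1]
  exact Icc_subset_Icc le_rfl hx.2

theorem intervalIntegrable_of_mem_Icc {Q : ℝ → ℝ} (hQ : IntervalIntegrable Q volume 0 Real.pi)
    {x : ℝ} (hx : x ∈ Icc (0 : ℝ) Real.pi) : IntervalIntegrable Q volume 0 x :=
  hQ.mono_set (by rw [uIcc_of_le Real.pi_pos.le]; exact uIcc_subset_Icc_pi hx)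

theorem continuousOn_primitive_pi {Q : ℝ → ℝ} (hQ : IntervalIntegrable Q volume 0 Real.pi) :
    ContinuousOn (fun x => ∫ t in (0 : ℝ)..x, Q t) (Icc 0 Real.pi) := by
  have := intervalIntegral.continuousOn_primitive_interval (μ := volume) (f := Q) (a := 0)
    (b := Real.pi) (by
      rw [uIcc_of_le Real.pi_pos.le, integrableOn_Icc_iff_integrableOn_Ioc]
      exact (intervalIntegrable_iff_integrableOn_Ioc_of_le Real.pi_pos.le).1 hQ)
  rwa [uIcc_of_le Real.pi_pos.le] at this

/-- Integration by parts against a primitive of an integrable function. -/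
theorem primitive_mul_eq_integral {Q y y1 : ℝ → ℝ} (hQ : IntervalIntegrable Q volume 0 Real.pi)
    (hy1 : ContinuousOn y1 (Icc 0 Real.pi)) (hyc : ContinuousOn y (Icc 0 Real.pi))
    (hy : ∀ x ∈ Icc (0 : ℝ) Real.pi, y x = y 0 + ∫ t in (0 : ℝ)..x, y1 t) {x : ℝ}
    (hx : x ∈ Icc (0 : ℝ) Real.pi) :
    (∫ t in (0 : ℝ)..x, Q t) * y x =
      ∫ t in (0 : ℝ)..x, (Q t * y t + (∫ s in (0 : ℝ)..t, Q s) * y1 t) := by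
  have hsub := uIcc_subset_Icc_pi hx
  have hQx := intervalIntegrable_of_mem_Icc hQ hx
  have hy1x : IntervalIntegrable y1 volume 0 x := (hy1.mono hsub).intervalIntegrable
  have key := AbsolutelyContinuousOnInterval.integral_deriv_mul_eq_sub
    (hQx.absolutelyContinuousOnInterval_intervalIntegral left_mem_uIcc)
    (hy1x.absolutelyContinuousOnInterval_intervalIntegral left_mem_uIcc)
  have hae : ∫ t in (0 : ℝ)..x, (Q t * y t + (∫ s in (0 : ℝ)..t, Q s) * y1 t) - y 0 * Q t =
      ∫ t in (0 : ℝ)..x, (deriv (fun t => ∫ s in (0 : ℝ)..t, Q s) t * (∫ s in (0 : ℝ)..t, y1 s) +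
        (∫ s in (0 : ℝ)..t, Q s) * deriv (fun t => ∫ s in (0 : ℝ)..t, y1 s) t) := by
    apply intervalIntegral.integral_congr_ae
    filter_upwards [hQx.ae_hasDerivAt_integral, hy1x.ae_hasDerivAt_integral] with t h1 h2 ht
    have ht' := uIoc_subset_uIcc ht
    rw [(h1 ht' 0 left_mem_uIcc).deriv, (h2 ht' 0 left_mem_uIcc).deriv, hy t (hsub ht')]
    ring
  rw [intervalIntegral.integral_sub, key, intervalIntegral.integral_const_mul] at hae
  · simp only [intervalIntegral.integral_same, zero_mul, sub_zero] at hae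
    rw [hy x hx]
    linarith
  · exact (hQx.mul_continuousOn (hyc.mono hsub)).add
      (((continuousOn_primitive_pi hQ).mono hsub).mul (hy1.mono hsub)).intervalIntegrable
  · exact hQx.const_mul _

theorem IsCaraSol.isSysR {Q y y1 : ℝ → ℝ} {lam : ℝ} (hQ : IntervalIntegrable Q volume 0 Real.pi)
    (h : IsCaraSol Q Real.pi lam y y1) :
    IsSysR (fun x => ∫ t in (0 : ℝ)..x, Q t) lam y
      (fun x => y1 x - (∫ t in (0 : ℝ)..x, Q t) * y x) := by
  obtain ⟨hyc, hy1c, hy, hy1⟩ := h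
  have hσ := continuousOn_primitive_pi hQ
  intro t ht
  have hc : ContinuousOn (fun s => -(lam * y s) - (∫ r in (0 : ℝ)..s, Q r) * y1 s)
      (Icc 0 Real.pi) := ((continuousOn_const.mul hyc).neg).sub (hσ.mul hy1c)
  refine ⟨?_, ?_⟩
  · have h1 := (hasDerivWithinAt_primitive hy1c ht).const_add (y 0)
    convert! h1.congr_of_mem (fun s hs => hy s hs) ht using 1
    ring
  · have h1 := (hasDerivWithinAt_primitive hc ht).const_add (y1 0)
    convert! h1.congr_of_mem (fun s hs => ?_) ht using 1
    · ring
    · have hsub := uIcc_subset_Icc_pi hs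
      have hQs := intervalIntegrable_of_mem_Icc hQ hs
      rw [primitive_mul_eq_integral hQ hy1c hyc hy hs, hy1 s hs, add_sub_assoc,
        ← intervalIntegral.integral_sub]
      · congr 1
        apply intervalIntegral.integral_congr
        intro r _
        simp only
        ring
      · exact (hQs.sub intervalIntegrable_const).mul_continuousOn (hyc.mono hsub)
      · exact (hQs.mul_continuousOn (hyc.mono hsub)).add
          ((hσ.mono hsub).mul (hy1c.mono hsub)).intervalIntegrable

theorem IsSysR.isCaraSol {Q y w : ℝ → ℝ} {lam : ℝ} (hQ : IntervalIntegrable Q volume 0 Real.pi)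
    (h : IsSysR (fun x => ∫ t in (0 : ℝ)..x, Q t) lam y w) :
    IsCaraSol Q Real.pi lam y (fun x => w x + (∫ t in (0 : ℝ)..x, Q t) * y x) := by
  have hyc := h.continuousOn_fst
  have hwc := h.continuousOn_snd
  have hσ := continuousOn_primitive_pi hQ
  have hy1c : ContinuousOn (fun x => w x + (∫ t in (0 : ℝ)..x, Q t) * y x) (Icc 0 Real.pi) :=
    hwc.add (hσ.mul hyc)
  have hy : ∀ x ∈ Icc (0 : ℝ) Real.pi,
      y x = y 0 + ∫ t in (0 : ℝ)..x, (w t + (∫ s in (0 : ℝ)..t, Q s) * y t) := fun x hx =>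
    eq_add_integral_of_hasDerivWithinAt hy1c
      (fun t ht => by convert! (h t ht).1 using 1; ring) hx
  refine ⟨hyc, hy1c, hy, fun x hx => ?_⟩
  have hsub := uIcc_subset_Icc_pi hx
  have hQx := intervalIntegrable_of_mem_Icc hQ hx
  have hc : ContinuousOn (fun t => -((∫ s in (0 : ℝ)..t, Q s) * w t) -
      ((∫ s in (0 : ℝ)..t, Q s) ^ 2 + lam) * y t) (Icc 0 Real.pi) :=
    (hσ.mul hwc).neg.sub (((hσ.pow 2).add continuousOn_const).mul hyc)
  have hw := eq_add_integral_of_hasDerivWithinAt hc (fun t ht => (h t ht).2) hx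
  beta_reduce
  rw [primitive_mul_eq_integral hQ hy1c hyc hy hx, hw, intervalIntegral.integral_same, zero_mul,
    add_zero, add_assoc, ← intervalIntegral.integral_add (hc.mono hsub).intervalIntegrable]
  · congr 1
    apply intervalIntegral.integral_congr
    intro r _
    simp only
    ring
  · exact (hQx.mul_continuousOn (hyc.mono hsub)).add
      ((hσ.mono hsub).mul (hy1c.mono hsub)).intervalIntegrable

theorem intervalIntegrable_reflect {q : ℝ → ℝ} (hq : IntervalIntegrable q volume 0 Real.pi) :
    IntervalIntegrable (fun t => q (Real.pi - t)) volume 0 Real.pi := by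
  have := hq.comp_sub_left Real.pi
  simp only [sub_zero, sub_self] at this
  exact this.symm

theorem IsCaraSol.reflect {q y y1 : ℝ → ℝ} {lam : ℝ} (hq : IntervalIntegrable q volume 0 Real.pi)
    (h : IsCaraSol q Real.pi lam y y1) :
    IsCaraSol (fun t => q (Real.pi - t)) Real.pi lam (fun t => y (Real.pi - t))
      (fun t => -y1 (Real.pi - t)) := by
  obtain ⟨hyc, hy1c, hy, hy1⟩ := h
  have hmap : MapsTo (fun t => Real.pi - t) (Icc (0 : ℝ) Real.pi) (Icc (0 : ℝ) Real.pi) :=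
    fun t ht => ⟨by linarith [ht.2], by linarith [ht.1]⟩
  have hcr : ContinuousOn (fun t => Real.pi - t) (Icc (0 : ℝ) Real.pi) := by fun_prop
  have split : ∀ g : ℝ → ℝ, IntervalIntegrable g volume 0 Real.pi → ∀ x ∈ Icc (0 : ℝ) Real.pi,
      (∫ t in (0 : ℝ)..Real.pi, g t) =
        (∫ t in (0 : ℝ)..(Real.pi - x), g t) + ∫ t in (0 : ℝ)..x, g (Real.pi - t) := by
    intro g hg x hx
    rw [intervalIntegral.integral_comp_sub_left g Real.pi, sub_zero,
      intervalIntegral.integral_add_adjacent_intervals]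
    · exact intervalIntegrable_of_mem_Icc hg (hmap hx)
    · exact (intervalIntegrable_of_mem_Icc hg (hmap hx)).symm.trans hg
  refine ⟨hyc.comp hcr hmap, (hy1c.comp hcr hmap).neg, fun x hx => ?_, fun x hx => ?_⟩
  · simp only [sub_zero]
    rw [hy _ (hmap hx), hy _ pi_mem_Icc_pi, intervalIntegral.integral_neg,
      split y1 (ContinuousOn.intervalIntegrable (by rwa [uIcc_of_le Real.pi_pos.le])) x hx]
    ring
  · simp only [sub_zero]
    have hg : IntervalIntegrable (fun t => (q t - lam) * y t) volume 0 Real.pi :=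
      (hq.sub intervalIntegrable_const).mul_continuousOn (by rwa [uIcc_of_le Real.pi_pos.le])
    have hs := split _ hg x hx
    rw [hy1 _ (hmap hx), hy1 _ pi_mem_Icc_pi, hs]
    ring

namespace RatHN

/-- The denominator of `f`. -/
def den (f : RatHN) (z : ℂ) : ℂ := ∏ j, ((f.β j : ℂ) - z)

/-- The denominator of `f` with one factor removed. -/
def denErase (f : RatHN) (j : Fin f.n) (z : ℂ) : ℂ :=
  ∏ k ∈ Finset.univ.erase j, ((f.β k : ℂ) - z)

/-- The numerator of `f`. -/
def num (f : RatHN) (z : ℂ) : ℂ :=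
  (f.a * z + f.c) * f.den z + ∑ j, (f.γ j : ℂ) * f.denErase j z

/-- The Christoffel–Darboux type kernel of `f`. -/
def ker (f : RatHN) (z ζ : ℂ) : ℂ :=
  f.a * (f.den z * f.den ζ) + ∑ j, (f.γ j : ℂ) * (f.denErase j z * f.denErase j ζ)

variable (f : RatHN)

theorem den_eq_mul_denErase (j : Fin f.n) (z : ℂ) :
    f.den z = (f.β j - z) * f.denErase j z :=
  (Finset.mul_prod_erase Finset.univ (fun k => (f.β k : ℂ) - z) (Finset.mem_univ j)).symm

theorem differentiable_den : Differentiable ℂ f.den := by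
  unfold den
  fun_prop

theorem differentiable_denErase (j : Fin f.n) : Differentiable ℂ (f.denErase j) := by
  unfold denErase
  fun_prop

theorem differentiable_num : Differentiable ℂ f.num := by
  have h1 := f.differentiable_den
  have h2 := f.differentiable_denErase
  unfold num
  fun_prop

theorem continuous_ker (z : ℂ) : Continuous (f.ker z) := by
  have h1 := f.differentiable_den.continuous
  have h2 := fun j => (f.differentiable_denErase j).continuous
  unfold ker
  fun_prop

theorem num_mul_den_sub (z ζ : ℂ) :
    f.num ζ * f.den z - f.num z * f.den ζ = (ζ - z) * f.ker z ζ := by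
  have h : ∀ j, (f.γ j : ℂ) * f.denErase j ζ * f.den z - (f.γ j : ℂ) * f.denErase j z * f.den ζ =
      (ζ - z) * ((f.γ j : ℂ) * (f.denErase j z * f.denErase j ζ)) := fun j => by
    rw [f.den_eq_mul_denErase j z, f.den_eq_mul_denErase j ζ]
    ring
  have hs := Finset.sum_congr (rfl : (Finset.univ : Finset (Fin f.n)) = _) (fun j _ => h j)
  rw [Finset.sum_sub_distrib, ← Finset.sum_mul, ← Finset.sum_mul, ← Finset.mul_sum] at hs
  unfold num ker
  linear_combination hs

theorem den_conj (z : ℂ) : f.den (starRingEnd ℂ z) = starRingEnd ℂ (f.den z) := by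
  simp [den, map_prod]

theorem denErase_conj (j : Fin f.n) (z : ℂ) :
    f.denErase j (starRingEnd ℂ z) = starRingEnd ℂ (f.denErase j z) := by
  simp [denErase, map_prod]

theorem num_conj (z : ℂ) : f.num (starRingEnd ℂ z) = starRingEnd ℂ (f.num z) := by
  simp [num, den_conj, denErase_conj]

theorem exists_ker_conj (z : ℂ) : ∃ r : ℝ, 0 ≤ r ∧ f.ker (starRingEnd ℂ z) z = r := by
  refine ⟨f.a * Complex.normSq (f.den z) + ∑ j, f.γ j * Complex.normSq (f.denErase j z), ?_, ?_⟩
  · exact add_nonneg (mul_nonneg f.ha (Complex.normSq_nonneg _))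
      (Finset.sum_nonneg fun j _ => mul_nonneg (f.hγ j).le (Complex.normSq_nonneg _))
  · simp only [ker, den_conj, denErase_conj, Complex.normSq_eq_conj_mul_self, Complex.ofReal_add,
      Complex.ofReal_mul, Complex.ofReal_sum]

theorem im_num_mul_conj_den_nonneg {z : ℂ} (hz : 0 ≤ z.im) :
    0 ≤ (f.num z * starRingEnd ℂ (f.den z)).im := by
  obtain ⟨r, hr, hk⟩ := f.exists_ker_conj z
  have h := f.num_mul_den_sub (starRingEnd ℂ z) z
  rw [hk, den_conj, num_conj] at h
  have h2 := congrArg Complex.im h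
  simp only [Complex.sub_im, Complex.mul_im, Complex.conj_re, Complex.conj_im, Complex.ofReal_re,
    Complex.ofReal_im, Complex.sub_re] at h2
  simp only [Complex.mul_im, Complex.conj_re, Complex.conj_im]
  nlinarith [mul_nonneg hz hr]

theorem den_eq_zero_iff {z : ℂ} : f.den z = 0 ↔ ∃ j, (f.β j : ℂ) = z := by
  simp [den, Finset.prod_eq_zero_iff, sub_eq_zero]

theorem den_ofReal_eq_zero_iff {x : ℝ} : f.den x = 0 ↔ f.IsPole x := by
  simp [den_eq_zero_iff, IsPole]

theorem denErase_self_ne_zero (j : Fin f.n) : f.denErase j (f.β j) ≠ 0 := by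
  rw [denErase, Finset.prod_ne_zero_iff]
  intro k hk
  rw [Finset.mem_erase] at hk
  rw [← Complex.ofReal_sub, Complex.ofReal_ne_zero, sub_ne_zero]
  exact fun h => hk.1 (f.hβ.injective h)

theorem num_β (j : Fin f.n) : f.num (f.β j) = f.γ j * f.denErase j (f.β j) := by
  have h0 : f.den (f.β j) = 0 := f.den_eq_zero_iff.2 ⟨j, rfl⟩
  rw [num, h0, mul_zero, zero_add]
  refine Finset.sum_eq_single j (fun k _ hk => ?_) (by simp)
  rw [denErase, Finset.prod_eq_zero (i := j) (by simp [hk.symm]) (by simp), mul_zero]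

theorem num_ne_zero_of_den_eq_zero {z : ℂ} (h : f.den z = 0) : f.num z ≠ 0 := by
  obtain ⟨j, rfl⟩ := f.den_eq_zero_iff.1 h
  rw [num_β]
  exact mul_ne_zero (Complex.ofReal_ne_zero.2 (f.hγ j).ne') (f.denErase_self_ne_zero j)

theorem num_eq_eval_mul_den {x : ℝ} (h : ¬ f.IsPole x) : f.num x = f.eval x * f.den x := by
  have h1 : ∀ j, (f.γ j : ℂ) * f.denErase j x = ((f.γ j / (f.β j - x) : ℝ) : ℂ) * f.den x := by
    intro j
    have h2 : (f.β j - x : ℂ) ≠ 0 := by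
      rw [← Complex.ofReal_sub, Complex.ofReal_ne_zero, sub_ne_zero]
      exact fun e => h ⟨j, e⟩
    rw [f.den_eq_mul_denErase j]
    push_cast
    field_simp
  rw [num, Finset.sum_congr rfl fun j _ => h1 j, ← Finset.sum_mul, eval]
  push_cast
  ring

/-- The boundary condition encoded by `f`, in polynomial form. -/
theorem boundary_iff {x y0 y1 : ℝ} :
    ((¬ f.IsPole x → y1 = -f.eval x * y0) ∧ (f.IsPole x → y0 = 0)) ↔
      f.den x * (-y1 : ℝ) = f.num x * y0 := by
  by_cases h : f.IsPole x
  · have hd := f.den_ofReal_eq_zero_iff.2 h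
    simp [h, hd, f.num_ne_zero_of_den_eq_zero hd]
  · have hd : f.den x ≠ 0 := fun e => h (f.den_ofReal_eq_zero_iff.1 e)
    rw [f.num_eq_eval_mul_den h, mul_comm (f.eval x : ℂ), mul_assoc, mul_right_inj' hd]
    simp only [h, not_false_eq_true, true_imp_iff, false_imp_iff, and_true]
    norm_cast
    constructor <;> intro e <;> linarith

theorem eval_le {x : ℝ} (hx : x ≤ 0) (hβ : ∀ j, x ≤ f.β j - 1) :
    f.eval x ≤ f.c + ∑ j, f.γ j := by
  have h1 : f.a * x ≤ 0 := mul_nonpos_of_nonneg_of_nonpos f.ha hx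
  have h2 : ∑ j, f.γ j / (f.β j - x) ≤ ∑ j, f.γ j :=
    Finset.sum_le_sum fun j _ => div_le_self (f.hγ j).le (by linarith [hβ j])
  unfold eval
  linarith

theorem dense_den_ne_zero : Dense {z : ℂ | f.den z ≠ 0} := by
  have h : {z : ℂ | f.den z ≠ 0} = (range fun j => (f.β j : ℂ))ᶜ := by
    ext z
    simp [den_eq_zero_iff]
  rw [h]
  exact (finite_range _).countable.dense_compl ℝ

/-- A rational Herglotz–Nevanlinna function is determined by its quotient representation. -/
theorem eq_of_cross_mul {f₁ f₂ : RatHN} (h : ∀ z, f₁.den z * f₂.num z = f₂.den z * f₁.num z) :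
    f₁ = f₂ := by
  have hz : ∀ g₁ g₂ : RatHN, (∀ z, g₁.den z * g₂.num z = g₂.den z * g₁.num z) →
      range g₁.β ⊆ range g₂.β := by
    rintro g₁ g₂ hg _ ⟨j, rfl⟩
    have h1 : g₁.den (g₁.β j) = 0 := g₁.den_eq_zero_iff.2 ⟨j, rfl⟩
    have h2 := hg (g₁.β j)
    rw [h1, zero_mul] at h2
    have h3 := (mul_eq_zero.1 h2.symm).resolve_right (g₁.num_ne_zero_of_den_eq_zero h1)
    exact g₂.den_ofReal_eq_zero_iff.1 h3
  have hr : range f₁.β = range f₂.β :=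
    (hz _ _ h).antisymm (hz _ _ fun z => (h z).symm)
  have hn : f₁.n = f₂.n := by
    have h1 := Set.ncard_range_of_injective f₁.hβ.injective
    have h2 := Set.ncard_range_of_injective f₂.hβ.injective
    rw [hr, h2] at h1
    simpa using h1.symm
  obtain ⟨a₁, c₁, n, γ₁, β₁, ha₁, hγ₁, hβ₁⟩ := f₁
  obtain ⟨a₂, c₂, n₂, γ₂, β₂, ha₂, hγ₂, hβ₂⟩ := f₂
  obtain rfl : n = n₂ := hn
  obtain rfl : β₁ = β₂ := (hβ₁.range_inj hβ₂).1 hr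
  set g₁ : RatHN := ⟨a₁, c₁, n, γ₁, β₁, ha₁, hγ₁, hβ₁⟩
  set g₂ : RatHN := ⟨a₂, c₂, n, γ₂, β₁, ha₂, hγ₂, hβ₂⟩
  have hnum : g₁.num = g₂.num := by
    refine Continuous.ext_on g₁.dense_den_ne_zero g₁.differentiable_num.continuous
      g₂.differentiable_num.continuous fun z hz => ?_
    exact (mul_left_cancel₀ hz (h z)).symm
  have hγ : γ₁ = γ₂ := by
    funext j
    have h1 := g₁.num_β j
    rw [hnum] at h1
    have h2 := (g₂.num_β j).symm.trans h1
    have h3 := mul_right_cancel₀ (g₁.denErase_self_ne_zero j) h2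
    exact_mod_cast h3.symm
  have hac : (fun z : ℂ => (a₁ : ℂ) * z + c₁) = fun z : ℂ => (a₂ : ℂ) * z + c₂ := by
    refine Continuous.ext_on g₁.dense_den_ne_zero (by fun_prop) (by fun_prop) fun z hz => ?_
    have h1 : (a₁ * z + c₁) * g₁.den z + ∑ j, (γ₁ j : ℂ) * g₁.denErase j z =
        (a₂ * z + c₂) * g₁.den z + ∑ j, (γ₂ j : ℂ) * g₁.denErase j z := congrFun hnum z
    rw [hγ] at h1
    exact mul_right_cancel₀ hz (add_right_cancel h1)
  have hc : c₁ = c₂ := by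
    have := congrFun hac 0
    simpa using this
  have ha : a₁ = a₂ := by
    have := congrFun hac 1
    simpa [hc] using this
  subst hγ hc ha
  rfl

end RatHN

/-- A barrier estimate for very negative spectral parameter. -/
theorem IsSysR.barrier {σ : ℝ → ℝ} {lam S L B : ℝ} {Y W : ℝ → ℝ} (h : IsSysR σ lam Y W)
    (hS : ∀ t ∈ Icc (0 : ℝ) Real.pi, |σ t| ≤ S) (hL : 0 ≤ L) (hBL : B < L)
    (hlam : (S + 3 * L) ^ 2 + L ≤ -lam) (h0 : Y 0 ≠ 0) (hB : -B * Y 0 ^ 2 ≤ W 0 * Y 0) {t : ℝ}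
    (ht : t ∈ Icc (0 : ℝ) Real.pi) : 0 < Y t * (W t - L * (t - 1) * Y t) := by
  have hd : ∀ s ∈ Icc (0 : ℝ) Real.pi,
      HasDerivWithinAt (fun s => Y s * (W s - L * (s - 1) * Y s))
        ((-lam - (σ s + L * (s - 1)) ^ 2 - L) * Y s ^ 2 + (W s - L * (s - 1) * Y s) ^ 2)
        (Icc 0 Real.pi) s := by
    intro s hs
    have h1 : HasDerivWithinAt (fun s : ℝ => L * (s - 1)) L (Icc 0 Real.pi) s := by
      simpa using ((hasDerivWithinAt_id s (Icc 0 Real.pi)).sub_const 1).const_mul L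
    convert! (h s hs).1.mul ((h s hs).2.sub (h1.mul (h s hs).1)) using 1
    simp only [Pi.sub_apply, Pi.mul_apply]
    ring
  have hmono : MonotoneOn (fun s => Y s * (W s - L * (s - 1) * Y s)) (Icc 0 Real.pi) := by
    refine monotoneOn_of_hasDerivWithinAt_nonneg (convex_Icc _ _)
      (fun s hs => (hd s hs).continuousWithinAt)
      (fun s hs => (hd s (interior_subset hs)).mono interior_subset) fun s hs => ?_
    have hs' : s ∈ Icc (0 : ℝ) Real.pi := interior_subset hs
    have h2 : |L * (s - 1)| ≤ 3 * L := by
      rw [abs_mul, abs_of_nonneg hL, mul_comm]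
      gcongr
      rw [abs_le]
      constructor <;> linarith [hs'.1, hs'.2, Real.pi_le_four]
    have h3 : (σ s + L * (s - 1)) ^ 2 ≤ (S + 3 * L) ^ 2 := by
      rw [← sq_abs (σ s + _)]
      gcongr
      exact (abs_add_le _ _).trans (add_le_add (hS s hs') h2)
    have h4 : 0 ≤ -lam - (σ s + L * (s - 1)) ^ 2 - L := by linarith
    positivity
  have h5 := hmono zero_mem_Icc_pi ht ht.1
  have h6 : 0 < Y 0 ^ 2 := by positivity
  refine lt_of_lt_of_le ?_ h5
  simp only
  nlinarith [mul_pos (sub_pos.2 hBL) h6]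

/-- The fundamental system of solutions, normalised at `0` and entire in the spectral parameter. -/
structure Fund (σ : ℝ → ℝ) where
  φ : ℝ → ℂ → ℂ
  φw : ℝ → ℂ → ℂ
  θ : ℝ → ℂ → ℂ
  θw : ℝ → ℂ → ℂ
  sysφ : ∀ z, IsSys σ z (fun t => φ t z) (fun t => φw t z)
  sysθ : ∀ z, IsSys σ z (fun t => θ t z) (fun t => θw t z)
  φ_zero : ∀ z, φ 0 z = 1
  φw_zero : ∀ z, φw 0 z = 0
  θ_zero : ∀ z, θ 0 z = 0
  θw_zero : ∀ z, θw 0 z = 1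
  diffφ : ∀ t, Differentiable ℂ (φ t)
  diffφw : ∀ t, Differentiable ℂ (φw t)
  diffθ : ∀ t, Differentiable ℂ (θ t)
  diffθw : ∀ t, Differentiable ℂ (θw t)
  contφ : Continuous (fun p : ℝ × ℂ => φ p.1 p.2)
  contθ : Continuous (fun p : ℝ × ℂ => θ p.1 p.2)

theorem Fund.nonempty {σ : ℝ → ℝ} (hσ : ContinuousOn σ (Icc 0 Real.pi)) : Nonempty (Fund σ) := by
  obtain ⟨φ, φw, h1, h2, h3, h4, h5, h6⟩ := exists_isSys hσ 1 0
  obtain ⟨θ, θw, k1, k2, k3, k4, k5, k6⟩ := exists_isSys hσ 0 1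
  exact ⟨⟨φ, φw, θ, θw, h1, k1, h2, h3, k2, k3, h4, h5, k4, k5, h6, k6⟩⟩

namespace Fund

variable {σ : ℝ → ℝ} (F : Fund σ) (f : RatHN)

theorem wronskian (z : ℂ) {t : ℝ} (ht : t ∈ Icc (0 : ℝ) Real.pi) :
    F.φ t z * F.θw t z - F.φw t z * F.θ t z = 1 := by
  have := (F.sysφ z).wronskian (F.sysθ z) ht
  simpa only [F.φ_zero, F.φw_zero, F.θ_zero, F.θw_zero, mul_one, mul_zero, sub_zero] using this

theorem φ_conj (hσ : ContinuousOn σ (Icc 0 Real.pi)) (z : ℂ) {t : ℝ}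
    (ht : t ∈ Icc (0 : ℝ) Real.pi) : F.φ t (starRingEnd ℂ z) = starRingEnd ℂ (F.φ t z) ∧
      F.φw t (starRingEnd ℂ z) = starRingEnd ℂ (F.φw t z) :=
  (F.sysφ _).unique hσ (F.sysφ z).conj (by simp [F.φ_zero]) (by simp [F.φw_zero]) ht

theorem θ_conj (hσ : ContinuousOn σ (Icc 0 Real.pi)) (z : ℂ) {t : ℝ}
    (ht : t ∈ Icc (0 : ℝ) Real.pi) : F.θ t (starRingEnd ℂ z) = starRingEnd ℂ (F.θ t z) ∧
      F.θw t (starRingEnd ℂ z) = starRingEnd ℂ (F.θw t z) :=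
  (F.sysθ _).unique hσ (F.sysθ z).conj (by simp [F.θ_zero]) (by simp [F.θw_zero]) ht

/-- Every solution is a combination of the fundamental solutions. -/
theorem eq_comb (hσ : ContinuousOn σ (Icc 0 Real.pi)) {z : ℂ} {y w : ℝ → ℂ} (h : IsSys σ z y w)
    {t : ℝ} (ht : t ∈ Icc (0 : ℝ) Real.pi) :
    y t = y 0 * F.φ t z + w 0 * F.θ t z ∧ w t = y 0 * F.φw t z + w 0 * F.θw t z :=
  h.unique hσ ((F.sysφ z).lin (F.sysθ z) (y 0) (w 0))
    (by simp [F.φ_zero, F.θ_zero]) (by simp [F.φw_zero, F.θw_zero]) ht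

/-- The boundary form of `f` evaluated on the solution `φ`. -/
def P (z : ℂ) : ℂ := f.den z * (F.φw Real.pi z + σ Real.pi * F.φ Real.pi z) -
  f.num z * F.φ Real.pi z

/-- The boundary form of `f` evaluated on the solution `θ`. -/
def R (z : ℂ) : ℂ := f.den z * (F.θw Real.pi z + σ Real.pi * F.θ Real.pi z) -
  f.num z * F.θ Real.pi z

/-- The solution satisfying the boundary condition of `f` at the right endpoint. -/
def ψ (t : ℝ) (z : ℂ) : ℂ := F.R f z * F.φ t z - F.P f z * F.θ t z

/-- The quasi-derivative of `ψ`. -/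
def ψw (t : ℝ) (z : ℂ) : ℂ := F.R f z * F.φw t z - F.P f z * F.θw t z

theorem differentiable_P : Differentiable ℂ (F.P f) := by
  have h1 := f.differentiable_den
  have h2 := f.differentiable_num
  have h3 := F.diffφ Real.pi
  have h4 := F.diffφw Real.pi
  unfold P
  fun_prop

theorem differentiable_R : Differentiable ℂ (F.R f) := by
  have h1 := f.differentiable_den
  have h2 := f.differentiable_num
  have h3 := F.diffθ Real.pi
  have h4 := F.diffθw Real.pi
  unfold R
  fun_prop

theorem sysψ (z : ℂ) : IsSys σ z (fun t => F.ψ f t z) (fun t => F.ψw f t z) := by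
  simpa only [ψ, ψw, sub_eq_add_neg, neg_mul] using
    (F.sysφ z).lin (F.sysθ z) (F.R f z) (-F.P f z)

theorem ψ_pi (z : ℂ) : F.ψ f Real.pi z = f.den z := by
  have := F.wronskian z pi_mem_Icc_pi
  unfold ψ P R
  linear_combination f.den z * this

theorem ψw_pi (z : ℂ) : F.ψw f Real.pi z = f.num z - σ Real.pi * f.den z := by
  have := F.wronskian z pi_mem_Icc_pi
  unfold ψw P R
  linear_combination (f.num z - σ Real.pi * f.den z) * this

theorem ψ_zero (z : ℂ) : F.ψ f 0 z = F.R f z := by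
  simp [ψ, F.φ_zero, F.θ_zero]

theorem ψw_zero (z : ℂ) : F.ψw f 0 z = -F.P f z := by
  simp [ψw, F.φw_zero, F.θw_zero]

theorem P_ne_zero_or_R_ne_zero (z : ℂ) : F.P f z ≠ 0 ∨ F.R f z ≠ 0 := by
  by_contra! h
  have h1 := F.ψ_pi f z
  have h2 := F.ψw_pi f z
  rw [ψ, h.1, h.2, zero_mul, zero_mul, sub_zero] at h1
  rw [ψw, h.1, h.2, ← h1, zero_mul, zero_mul, mul_zero, sub_zero, sub_zero] at h2
  exact f.num_ne_zero_of_den_eq_zero h1.symm h2.symm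

theorem P_conj (hσ : ContinuousOn σ (Icc 0 Real.pi)) (z : ℂ) :
    F.P f (starRingEnd ℂ z) = starRingEnd ℂ (F.P f z) := by
  simp [P, f.den_conj, f.num_conj, (F.φ_conj hσ z pi_mem_Icc_pi).1,
    (F.φ_conj hσ z pi_mem_Icc_pi).2]

theorem R_conj (hσ : ContinuousOn σ (Icc 0 Real.pi)) (z : ℂ) :
    F.R f (starRingEnd ℂ z) = starRingEnd ℂ (F.R f z) := by
  simp [R, f.den_conj, f.num_conj, (F.θ_conj hσ z pi_mem_Icc_pi).1,
    (F.θ_conj hσ z pi_mem_Icc_pi).2]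

theorem ψ_conj (hσ : ContinuousOn σ (Icc 0 Real.pi)) (z : ℂ) {t : ℝ}
    (ht : t ∈ Icc (0 : ℝ) Real.pi) :
    F.ψ f t (starRingEnd ℂ z) = starRingEnd ℂ (F.ψ f t z) := by
  simp [ψ, F.P_conj f hσ, F.R_conj f hσ, (F.φ_conj hσ z ht).1, (F.θ_conj hσ z ht).1]

theorem ofReal_re_of_conj {g : ℂ → ℂ} (hg : ∀ z, g (starRingEnd ℂ z) = starRingEnd ℂ (g z))
    (x : ℝ) : ((g x).re : ℂ) = g x := by
  have := hg x
  rw [Complex.conj_ofReal] at this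
  exact (Complex.conj_eq_iff_re.1 this.symm)

/-- The real solution `φ − b θ` at a real spectral parameter. -/
theorem exists_isSysR (hσ : ContinuousOn σ (Icc 0 Real.pi)) (b lam : ℝ) :
    ∃ Y W : ℝ → ℝ, IsSysR σ lam Y W ∧ Y 0 = 1 ∧ W 0 = -b ∧
      (f.den lam * ((W Real.pi + σ Real.pi * Y Real.pi : ℝ) : ℂ) - f.num lam * Y Real.pi =
        F.P f lam - b * F.R f lam) := by
  have hsys := (F.sysφ lam).lin (F.sysθ lam) 1 (-(b : ℂ))
  refine ⟨_, _, hsys.re, ?_, ?_, ?_⟩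
  · simp [F.φ_zero, F.θ_zero]
  · simp [F.φw_zero, F.θw_zero]
  · have h1 := ofReal_re_of_conj (g := F.φ Real.pi) (fun z => (F.φ_conj hσ z pi_mem_Icc_pi).1) lam
    have h2 := ofReal_re_of_conj (g := F.φw Real.pi) (fun z => (F.φ_conj hσ z pi_mem_Icc_pi).2) lam
    have h3 := ofReal_re_of_conj (g := F.θ Real.pi) (fun z => (F.θ_conj hσ z pi_mem_Icc_pi).1) lam
    have h4 := ofReal_re_of_conj (g := F.θw Real.pi) (fun z => (F.θ_conj hσ z pi_mem_Icc_pi).2) lam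
    unfold P R
    rw [← h1, ← h2, ← h3, ← h4]
    simp [← Complex.ofReal_neg]
    push_cast
    ring

end Fund

/-- The characteristic equation for the eigenvalues. -/
theorem isEigen_iff {q : ℝ → ℝ} (hq : IntervalIntegrable q volume 0 Real.pi) (f : RatHN)
    (F : Fund (fun x => ∫ t in (0 : ℝ)..x, q (Real.pi - t))) (b lam : ℝ) :
    IsEigen q f (some b) lam ↔ F.P f lam - b * F.R f lam = 0 := by
  have hQ := intervalIntegrable_reflect hq
  have hσ := continuousOn_primitive_pi hQ
  constructor
  · rintro ⟨y, y1, hy, ⟨x, hx, hyx⟩, hf1, hf2, hb, -⟩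
    have hb' := hb b rfl
    have hbd := f.boundary_iff.1 ⟨hf1, hf2⟩
    have hR := (hy.reflect hq).isSysR hQ
    have hc := fun t ht => F.eq_comb hσ hR.toIsSys (t := t) ht
    simp only [intervalIntegral.integral_same, zero_mul, sub_zero, hb'] at hc
    have hne : y Real.pi ≠ 0 := by
      intro h0
      have := (hc (Real.pi - x) ⟨by linarith [hx.2], by linarith [hx.1]⟩).1
      simp only [sub_sub_cancel, h0] at this
      simp at this
      exact hyx this
    have hp := hc _ pi_mem_Icc_pi
    simp only [sub_self] at hp
    obtain ⟨h1, h2⟩ := hp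
    have h3 : ((-y1 0 : ℝ) : ℂ) = ((-y1 0 - (∫ t in (0 : ℝ)..Real.pi, q (Real.pi - t)) * y 0 : ℝ) : ℂ)
        + ((∫ t in (0 : ℝ)..Real.pi, q (Real.pi - t) : ℝ) : ℂ) * (y 0 : ℂ) := by
      push_cast; ring
    rw [h3, h2, h1] at hbd
    have hne' : (y Real.pi : ℂ) ≠ 0 := Complex.ofReal_ne_zero.2 hne
    apply mul_left_cancel₀ hne'
    unfold Fund.P Fund.R
    push_cast at hbd ⊢
    linear_combination hbd
  · intro h
    obtain ⟨Y, W, hYW, hY0, hW0, hPR⟩ := F.exists_isSysR f hσ b lam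
    rw [h, sub_eq_zero] at hPR
    have hcs := (hYW.isCaraSol hQ).reflect hQ
    simp only [sub_sub_cancel] at hcs
    have hbd := f.boundary_iff (x := lam) (y0 := Y Real.pi)
      (y1 := -(W Real.pi + (∫ t in (0 : ℝ)..Real.pi, q (Real.pi - t)) * Y Real.pi))
    rw [neg_neg] at hbd
    obtain ⟨h1, h2⟩ := hbd.2 hPR
    refine ⟨_, _, hcs, ⟨Real.pi, pi_mem_Icc_pi, by simp [hY0]⟩, ?_, ?_, ?_, ?_⟩
    · simpa using h1
    · simpa using h2
    · rintro _ ⟨⟩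
      simp [hY0, hW0]
    · intro h
      exact absurd h (by simp)

namespace Fund

variable {σ : ℝ → ℝ} (F : Fund σ) (f : RatHN)

theorem P_sub_ne_zero_of_lt (hσ : ContinuousOn σ (Icc 0 Real.pi)) (B : ℝ) :
    ∃ m : ℝ, ∀ b ≤ B, ∀ lam : ℝ, F.P f lam - b * F.R f lam = 0 → m ≤ lam := by
  obtain ⟨S, hS⟩ := isCompact_Icc.exists_bound_of_continuousOn hσ
  obtain ⟨M, hM⟩ := (finite_range f.β).bddBelow
  set C := f.c + ∑ j, f.γ j
  set L := max (max (B + 1) (C + S)) 0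
  refine ⟨min (min 0 (M - 1)) (-((S + 3 * L) ^ 2 + L)), fun b hb lam h => ?_⟩
  by_contra! hlt
  rw [lt_min_iff, lt_min_iff] at hlt
  obtain ⟨⟨h1, h2⟩, h3⟩ := hlt
  have hβ : ∀ j, M ≤ f.β j := fun j => hM ⟨j, rfl⟩
  have hnp : ¬ f.IsPole lam := by
    rintro ⟨j, hj⟩
    linarith [hβ j]
  have hev : f.eval lam ≤ C := f.eval_le h1.le fun j => by linarith [hβ j]
  obtain ⟨Y, W, hYW, hY0, hW0, hPR⟩ := F.exists_isSysR f hσ b lam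
  have hL : 0 ≤ L := le_max_right _ _
  have hLB : B < L := by
    have : B + 1 ≤ L := (le_max_left _ _).trans (le_max_left _ _)
    linarith
  have hLC : C + S ≤ L := (le_max_right _ _).trans (le_max_left _ _)
  have hbar := hYW.barrier hS hL hLB (by linarith) (by simp [hY0])
    (by rw [hY0, hW0]; linarith) pi_mem_Icc_pi
  rw [h, f.num_eq_eval_mul_den hnp, mul_right_comm, mul_comm (_ * _) (f.den lam), ← mul_sub,
    mul_eq_zero, or_iff_right (mt f.den_ofReal_eq_zero_iff.1 hnp)] at hPR
  have hreal : W Real.pi + σ Real.pi * Y Real.pi - f.eval lam * Y Real.pi = 0 := by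
    exact_mod_cast hPR
  have hσπ := (abs_le.1 (hS _ pi_mem_Icc_pi)).1
  have h5 : W Real.pi = (f.eval lam - σ Real.pi) * Y Real.pi := by linear_combination hreal
  rw [h5] at hbar
  have h6 : f.eval lam - σ Real.pi - L * (Real.pi - 1) ≤ 0 := by
    nlinarith [Real.pi_gt_three]
  nlinarith [mul_nonneg (sq_nonneg (Y Real.pi)) (neg_nonneg.2 h6)]

theorem continuous_ψ : Continuous (fun p : ℝ × ℂ => F.ψ f p.1 p.2) := by
  have h1 := (F.differentiable_P f).continuous
  have h2 := (F.differentiable_R f).continuous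
  have h3 := F.contφ
  have h4 := F.contθ
  unfold ψ
  fun_prop

/-- The reproducing kernel of the boundary value problem. -/
def K (z ζ : ℂ) : ℂ := f.ker z ζ + ∫ t in (0 : ℝ)..Real.pi, F.ψ f t z * F.ψ f t ζ

theorem continuous_K (z : ℂ) : Continuous (F.K f z) := by
  have h1 := F.continuous_ψ f
  refine (f.continuous_ker z).add
    (intervalIntegral.continuous_parametric_intervalIntegral_of_continuous' ?_ _ _)
  have h2 : Continuous fun p : ℂ × ℝ => F.ψ f p.2 z * F.ψ f p.2 p.1 := by fun_prop
  exact h2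

/-- Lagrange's identity. -/
theorem P_mul_R_sub (z ζ : ℂ) :
    F.P f ζ * F.R f z - F.R f ζ * F.P f z = (ζ - z) * -F.K f z ζ := by
  have hd : ∀ t ∈ Icc (0 : ℝ) Real.pi,
      HasDerivWithinAt (fun t => F.ψ f t z * F.ψw f t ζ - F.ψw f t z * F.ψ f t ζ)
        ((z - ζ) * (F.ψ f t z * F.ψ f t ζ)) (Icc 0 Real.pi) t := by
    intro t ht
    convert! ((F.sysψ f z t ht).1.mul (F.sysψ f ζ t ht).2).sub
      ((F.sysψ f z t ht).2.mul (F.sysψ f ζ t ht).1) using 1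
    ring
  have hc : Continuous fun t : ℝ => F.ψ f t z * F.ψ f t ζ := by
    have h1 := F.continuous_ψ f
    fun_prop
  have key := intervalIntegral.integral_eq_sub_of_hasDerivAt_of_le Real.pi_pos.le
    (fun t ht => (hd t ht).continuousWithinAt)
    (fun t ht => (hd t (Ioo_subset_Icc_self ht)).hasDerivAt (Icc_mem_nhds ht.1 ht.2))
    (Continuous.intervalIntegrable (by fun_prop) _ _)
  rw [intervalIntegral.integral_const_mul] at key
  simp only [ψ_pi, ψw_pi, ψ_zero, ψw_zero] at key
  have hk := f.num_mul_den_sub z ζ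
  unfold K
  linear_combination -key - hk

theorem exists_ψ_ne_zero (z : ℂ) : ∃ t ∈ Icc (0 : ℝ) Real.pi, F.ψ f t z ≠ 0 := by
  by_contra! h
  have hR : F.R f z = 0 := by rw [← F.ψ_zero f z]; exact h 0 zero_mem_Icc_pi
  have hP : F.P f z ≠ 0 := (F.P_ne_zero_or_R_ne_zero f z).resolve_right (not_not.2 hR)
  have hθ : ∀ t ∈ Icc (0 : ℝ) Real.pi, F.θ t z = 0 := by
    intro t ht
    have := h t ht
    rw [ψ, hR, zero_mul, zero_sub, neg_eq_zero, mul_eq_zero] at this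
    exact this.resolve_left hP
  have h1 := (F.sysθ z 0 zero_mem_Icc_pi).1
  have h2 : HasDerivWithinAt (fun t => F.θ t z) 0 (Icc 0 Real.pi) 0 :=
    (hasDerivWithinAt_const (0 : ℝ) (Icc 0 Real.pi) (0 : ℂ)).congr_of_mem hθ zero_mem_Icc_pi
  have h3 := (uniqueDiffOn_Icc Real.pi_pos 0 zero_mem_Icc_pi).eq_deriv _ h1 h2
  simp [F.θ_zero, F.θw_zero] at h3

theorem K_self_ne_zero (hσ : ContinuousOn σ (Icc 0 Real.pi)) (x : ℝ) : F.K f x x ≠ 0 := by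
  obtain ⟨r, hr, hk⟩ := f.exists_ker_conj x
  rw [Complex.conj_ofReal] at hk
  have hre : ∀ t ∈ Icc (0 : ℝ) Real.pi, ((F.ψ f t x).re : ℂ) = F.ψ f t x := fun t ht =>
    ofReal_re_of_conj (fun z => F.ψ_conj f hσ z ht) x
  obtain ⟨t, ht, hψ⟩ := F.exists_ψ_ne_zero f x
  have hc : Continuous fun t : ℝ => (F.ψ f t x).re := by
    have h1 : Continuous fun t : ℝ => F.ψ f t x := (F.continuous_ψ f).comp₂ continuous_id continuous_const
    exact Complex.continuous_re.comp h1
  have hpos : 0 < ∫ t in (0 : ℝ)..Real.pi, (F.ψ f t x).re ^ 2 := by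
    refine intervalIntegral.integral_pos Real.pi_pos (hc.pow 2).continuousOn
      (fun s _ => sq_nonneg _) ⟨t, ht, ?_⟩
    have : (F.ψ f t x).re ≠ 0 := fun h0 => hψ (by rw [← hre t ht, h0, Complex.ofReal_zero])
    positivity
  have hint : ∫ t in (0 : ℝ)..Real.pi, F.ψ f t x * F.ψ f t x =
      ((∫ t in (0 : ℝ)..Real.pi, (F.ψ f t x).re ^ 2 : ℝ) : ℂ) := by
    rw [← intervalIntegral.integral_ofReal]
    apply intervalIntegral.integral_congr
    intro s hs
    rw [uIcc_of_le Real.pi_pos.le] at hs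
    beta_reduce
    rw [Complex.ofReal_pow, hre s hs, sq]
  rw [K, hk, hint, ← Complex.ofReal_add, Complex.ofReal_ne_zero]
  positivity

theorem deriv_P_mul_R_sub_ne_zero (hσ : ContinuousOn σ (Icc 0 Real.pi)) (x : ℝ) :
    deriv (F.P f) x * F.R f x - deriv (F.R f) x * F.P f x ≠ 0 := by
  have h1 : HasDerivAt (fun ζ => F.P f ζ * F.R f x - F.R f ζ * F.P f x)
      (deriv (F.P f) x * F.R f x - deriv (F.R f) x * F.P f x) (x : ℂ) :=
    ((F.differentiable_P f x).hasDerivAt.mul_const _).sub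
      ((F.differentiable_R f x).hasDerivAt.mul_const _)
  have h2 : HasDerivAt (fun ζ => F.P f ζ * F.R f x - F.R f ζ * F.P f x) (-F.K f x x) (x : ℂ) := by
    rw [hasDerivAt_iff_tendsto_slope]
    have hc : Filter.Tendsto (fun ζ => -F.K f x ζ) (nhdsWithin (x : ℂ) {(x : ℂ)}ᶜ)
        (nhds (-F.K f x x)) := ((F.continuous_K f x).neg.tendsto _).mono_left nhdsWithin_le_nhds
    refine hc.congr' ?_
    filter_upwards [self_mem_nhdsWithin] with ζ hζ
    have hne : ζ - x ≠ 0 := sub_ne_zero.2 hζ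
    rw [slope_def_field, F.P_mul_R_sub f x ζ, F.P_mul_R_sub f x x]
    field_simp
    simp
  rw [h1.unique h2]
  exact neg_ne_zero.2 (F.K_self_ne_zero f hσ x)

/-- Interlacing: between two eigenvalues for one boundary parameter there is one for any other. -/
theorem exists_mem_Icc_of_ne (hσ : ContinuousOn σ (Icc 0 Real.pi)) {b b' x₀ x₁ : ℝ} (hb : b ≠ b')
    (hx : x₀ < x₁) (h₀ : F.P f x₀ - b * F.R f x₀ = 0) (h₁ : F.P f x₁ - b * F.R f x₁ = 0) :
    ∃ x ∈ Icc x₀ x₁, F.P f x - b' * F.R f x = 0 := by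
  by_contra! hne
  have hP := ofReal_re_of_conj (F.P_conj f hσ)
  have hR := ofReal_re_of_conj (F.R_conj f hσ)
  have hdP : ∀ x : ℝ, HasDerivAt (fun x : ℝ => (F.P f x).re) (deriv (F.P f) x).re x := fun x =>
    (F.differentiable_P f x).hasDerivAt.real_of_complex
  have hdR : ∀ x : ℝ, HasDerivAt (fun x : ℝ => (F.R f x).re) (deriv (F.R f) x).re x := fun x =>
    (F.differentiable_R f x).hasDerivAt.real_of_complex
  have hP' : ∀ x : ℝ, ((deriv (F.P f) x).re : ℂ) = deriv (F.P f) x := fun x => by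
    have h1 := (hdP x).ofReal_comp
    simp only [hP] at h1
    exact h1.unique (F.differentiable_P f x).hasDerivAt.comp_ofReal
  have hR' : ∀ x : ℝ, ((deriv (F.R f) x).re : ℂ) = deriv (F.R f) x := fun x => by
    have h1 := (hdR x).ofReal_comp
    simp only [hR] at h1
    exact h1.unique (F.differentiable_R f x).hasDerivAt.comp_ofReal
  have hne' : ∀ x ∈ Icc x₀ x₁, (F.P f x).re - b' * (F.R f x).re ≠ 0 := fun x hx h => by
    refine hne x hx ?_
    rw [← hP, ← hR]
    exact_mod_cast h
  have hend : ∀ x : ℝ, F.P f x - b * F.R f x = 0 → (F.P f x).re - b * (F.R f x).re = 0 :=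
    fun x hx => by
      rw [← hP, ← hR] at hx
      exact_mod_cast hx
  have hd : ∀ x ∈ Icc x₀ x₁, HasDerivAt
      (fun x : ℝ => ((F.P f x).re - b * (F.R f x).re) / ((F.P f x).re - b' * (F.R f x).re)) _ x :=
    fun x hx => ((hdP x).sub ((hdR x).const_mul b)).div ((hdP x).sub ((hdR x).const_mul b'))
      (hne' x hx)
  obtain ⟨x, hx, h⟩ := exists_hasDerivAt_eq_zero hx
    (fun x hx => (hd x hx).continuousAt.continuousWithinAt)
    (by rw [hend _ h₀, hend _ h₁, zero_div, zero_div]) (fun x hx => hd x (Ioo_subset_Icc_self hx))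
  have hxI := Ioo_subset_Icc_self hx
  simp only [div_eq_zero_iff, pow_eq_zero_iff two_ne_zero] at h
  have h5 := h.resolve_right (hne' x hxI)
  have h6 : (b' - b) * ((deriv (F.P f) x).re * (F.R f x).re -
      (deriv (F.R f) x).re * (F.P f x).re) = 0 := by
    simp only [Pi.sub_apply] at h5
    linear_combination -h5
  have h7 := (mul_eq_zero.1 h6).resolve_left (sub_ne_zero.2 hb.symm)
  refine F.deriv_P_mul_R_sub_ne_zero f hσ x ?_
  rw [← hP, ← hR, ← hP', ← hR']
  exact_mod_cast h7

end Fund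

/-- Coincidence of the lowest eigenvalues makes the characteristic functions proportional. -/
theorem cross_mul_eq {σ₁ σ₂ : ℝ → ℝ} (hσ₁ : ContinuousOn σ₁ (Icc 0 Real.pi))
    (F₁ : Fund σ₁) (F₂ : Fund σ₂) (f₁ f₂ : RatHN) {b : ℕ → ℝ} (hb : Function.Injective b)
    (hbdd : BddAbove (range b))
    (h : ∀ j : ℕ, ∃ Λ : ℕ → ℝ, IsEnum {x : ℝ | F₁.P f₁ x - b j * F₁.R f₁ x = 0} Λ ∧
      F₂.P f₂ (Λ 0) - b j * F₂.R f₂ (Λ 0) = 0) (z : ℂ) :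
    F₁.P f₁ z * F₂.R f₂ z = F₂.P f₂ z * F₁.R f₁ z := by
  choose Λ hΛ h2 using h
  have hmem : ∀ j k, F₁.P f₁ (Λ j k) - b j * F₁.R f₁ (Λ j k) = 0 := fun j k => by
    have : Λ j k ∈ range (Λ j) := ⟨k, rfl⟩
    rwa [(hΛ j).2] at this
  obtain ⟨B, hB⟩ := hbdd
  obtain ⟨m, hm⟩ := F₁.P_sub_ne_zero_of_lt f₁ hσ₁ B
  have hlow : ∀ j, m ≤ Λ j 0 := fun j => hm (b j) (hB ⟨j, rfl⟩) _ (hmem j 0)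
  have hleast : ∀ j (x : ℝ), F₁.P f₁ x - b j * F₁.R f₁ x = 0 → Λ j 0 ≤ x := fun j x hx => by
    have : x ∈ range (Λ j) := by rw [(hΛ j).2]; exact hx
    obtain ⟨k, rfl⟩ := this
    exact (hΛ j).1.monotone (Nat.zero_le k)
  have hupp : ∀ j, Λ j 0 ≤ Λ 0 1 := fun j => by
    rcases eq_or_ne (b 0) (b j) with e | e
    · rw [← hb e]
      exact (hΛ 0).1.monotone (Nat.zero_le 1)
    · obtain ⟨x, hx, hx0⟩ := F₁.exists_mem_Icc_of_ne f₁ hσ₁ e ((hΛ 0).1 Nat.zero_lt_one)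
        (hmem 0 0) (hmem 0 1)
      exact (hleast j x hx0).trans hx.2
  have hinj : Function.Injective fun j => ((Λ j 0 : ℝ) : ℂ) := by
    intro i j hij
    by_contra hne
    have hij' : Λ i 0 = Λ j 0 := Complex.ofReal_injective hij
    have h3 := hmem i 0
    have h4 := hmem j 0
    rw [← hij'] at h4
    have h5 : ((b i : ℂ) - b j) * F₁.R f₁ (Λ i 0) = 0 := by linear_combination h4 - h3
    have h6 : (b i : ℂ) - b j ≠ 0 := by
      rw [← Complex.ofReal_sub, Complex.ofReal_ne_zero, sub_ne_zero]
      exact fun e => hne (hb e)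
    have h7 := (mul_eq_zero.1 h5).resolve_left h6
    rw [h7, mul_zero, sub_zero] at h3
    exact (F₁.P_ne_zero_or_R_ne_zero f₁ _).elim (fun h => h h3) (fun h => h h7)
  obtain ⟨z₀, -, hz₀⟩ := (infinite_range_of_injective hinj).exists_accPt_of_subset_isCompact
    ((isCompact_Icc (a := m) (b := Λ 0 1)).image Complex.continuous_ofReal)
    (by rintro _ ⟨j, rfl⟩; exact ⟨_, ⟨hlow j, hupp j⟩, rfl⟩)
  rw [accPt_iff_frequently_nhdsNE] at hz₀
  have hd1 : Differentiable ℂ fun z => F₁.P f₁ z * F₂.R f₂ z :=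
    (F₁.differentiable_P f₁).mul (F₂.differentiable_R f₂)
  have hd2 : Differentiable ℂ fun z => F₂.P f₂ z * F₁.R f₁ z :=
    (F₂.differentiable_P f₂).mul (F₁.differentiable_R f₁)
  refine congrFun (AnalyticOnNhd.eq_of_frequently_eq (z₀ := z₀) (fun z _ => hd1.analyticAt z)
    (fun z _ => hd2.analyticAt z) (hz₀.mono ?_)) z
  rintro _ ⟨j, rfl⟩
  linear_combination F₂.R f₂ (Λ j 0) * hmem j 0 - F₁.R f₁ (Λ j 0) * h2 j

section Oscillation

variable {C η t : ℝ} {p r p' r' : ℝ → ℝ}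

theorem add_le_of_abs_deriv_le (hη : 0 ≤ η)
    (hp : ∀ s ∈ Icc (0 : ℝ) Real.pi, HasDerivWithinAt p (p' s) (Icc 0 Real.pi) s)
    (hr : ∀ s ∈ Icc (0 : ℝ) Real.pi, HasDerivWithinAt r (r' s) (Icc 0 Real.pi) s)
    (hr0 : ∀ s, 0 ≤ r s)
    (hp' : ∀ s ∈ Icc (0 : ℝ) Real.pi, |p' s| ≤ C * (3 * p s + r s))
    (hr' : ∀ s ∈ Icc (0 : ℝ) Real.pi, |r' s + 4 * η * r s| ≤ C * (p s + 3 * r s))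
    (ht : t ∈ Icc (0 : ℝ) Real.pi) :
    p t + r t ≤ (p 0 + r 0) * Real.exp (4 * C * t) := by
  have hd : ∀ s ∈ Icc (0 : ℝ) Real.pi,
      HasDerivWithinAt (fun s => (p s + r s) * Real.exp (-(4 * C) * s))
        ((p' s + r' s - 4 * C * (p s + r s)) * Real.exp (-(4 * C) * s)) (Icc 0 Real.pi) s := by
    intro s hs
    have h1 : HasDerivWithinAt (fun s : ℝ => Real.exp (-(4 * C) * s))
        (Real.exp (-(4 * C) * s) * -(4 * C)) (Icc 0 Real.pi) s := by
      simpa using (((hasDerivAt_id s).const_mul (-(4 * C))).exp).hasDerivWithinAt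
    convert! ((hp s hs).add (hr s hs)).mul h1 using 1
    simp only [Pi.add_apply]
    ring
  have hanti := antitoneOn_of_hasDerivWithinAt_nonpos (convex_Icc 0 Real.pi)
    (fun s hs => (hd s hs).continuousWithinAt)
    (fun s hs => (hd s (interior_subset hs)).mono interior_subset) fun s hs => by
      have hs' : s ∈ Icc (0 : ℝ) Real.pi := interior_subset hs
      have h1 := (abs_le.1 (hp' s hs')).2
      have h2 := (abs_le.1 (hr' s hs')).2
      have h3 := mul_nonneg hη (hr0 s)
      exact mul_nonpos_of_nonpos_of_nonneg (by linarith) (Real.exp_pos _).le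
  have h := hanti zero_mem_Icc_pi ht ht.1
  simp only [mul_zero, Real.exp_zero, mul_one, neg_mul, Real.exp_neg] at h
  rwa [← div_eq_mul_inv, div_le_iff₀ (Real.exp_pos _)] at h

theorem le_exp_add_of_deriv_le {K : ℝ} (hη : 0 < η) (hK : 0 ≤ K)
    (hr : ∀ s ∈ Icc (0 : ℝ) Real.pi, HasDerivWithinAt r (r' s) (Icc 0 Real.pi) s)
    (hr' : ∀ s ∈ Icc (0 : ℝ) Real.pi, r' s + 4 * η * r s ≤ K) (ht : t ∈ Icc (0 : ℝ) Real.pi) :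
    r t ≤ r 0 * Real.exp (-(4 * η * t)) + K / (4 * η) := by
  have hd : ∀ s ∈ Icc (0 : ℝ) Real.pi,
      HasDerivWithinAt (fun s => (r s - K / (4 * η)) * Real.exp (4 * η * s))
        ((r' s + 4 * η * r s - K) * Real.exp (4 * η * s)) (Icc 0 Real.pi) s := by
    intro s hs
    have h1 : HasDerivWithinAt (fun s : ℝ => Real.exp (4 * η * s))
        (Real.exp (4 * η * s) * (4 * η)) (Icc 0 Real.pi) s := by
      simpa using (((hasDerivAt_id s).const_mul (4 * η)).exp).hasDerivWithinAt
    convert! ((hr s hs).sub_const (K / (4 * η))).mul h1 using 1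
    field_simp
    ring
  have hanti := antitoneOn_of_hasDerivWithinAt_nonpos (convex_Icc 0 Real.pi)
    (fun s hs => (hd s hs).continuousWithinAt)
    (fun s hs => (hd s (interior_subset hs)).mono interior_subset) fun s hs =>
      mul_nonpos_of_nonpos_of_nonneg (by linarith [hr' s (interior_subset hs)]) (Real.exp_pos _).le
  have h := hanti zero_mem_Icc_pi ht ht.1
  simp only [mul_zero, Real.exp_zero, mul_one] at h
  rw [← le_div_iff₀ (Real.exp_pos _), div_eq_mul_inv _ (Real.exp _), ← Real.exp_neg, sub_mul] at h
  have : 0 ≤ K / (4 * η) * Real.exp (-(4 * η * t)) := by positivity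
  linarith

theorem exists_oscillation_bounds (hC : 0 ≤ C) (ht0 : 0 < t) (ht1 : t ≤ Real.pi) :
    ∃ η₀ K c : ℝ, 1 ≤ η₀ ∧ 0 < c ∧ ∀ η : ℝ, η₀ ≤ η → ∀ p r p' r' : ℝ → ℝ,
      (∀ s ∈ Icc (0 : ℝ) Real.pi, HasDerivWithinAt p (p' s) (Icc 0 Real.pi) s) →
      (∀ s ∈ Icc (0 : ℝ) Real.pi, HasDerivWithinAt r (r' s) (Icc 0 Real.pi) s) →
      (∀ s, 0 ≤ p s) → (∀ s, 0 ≤ r s) → p 0 = 1 → r 0 = 1 →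
      (∀ s ∈ Icc (0 : ℝ) Real.pi, |p' s| ≤ C * (3 * p s + r s)) →
      (∀ s ∈ Icc (0 : ℝ) Real.pi, |r' s + 4 * η * r s| ≤ C * (p s + 3 * r s)) →
      p t + r t ≤ K ∧ c ≤ p t ∧ 20 * r t ≤ p t := by
  have ht : t ∈ Icc (0 : ℝ) Real.pi := ⟨ht0.le, ht1⟩
  have hpi := Real.pi_pos
  set K1 := 2 * Real.exp (4 * C * Real.pi) with hK1
  have hK1p : 0 < K1 := by positivity
  set K2 := 3 * C * K1 with hK2
  have hK2p : 0 ≤ K2 := by positivity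
  set M := Real.exp (3 * C * Real.pi) with hM
  have hMp : 0 < M := Real.exp_pos _
  refine ⟨max 1 (max (C * M * (1 + K2 * Real.pi)) (10 * M * (1 / t + K2))), K1, 1 / (2 * M),
    le_max_left _ _, by positivity, ?_⟩
  intro η hη p r p' r' hp hr hp0 hr0 hpi0 hri0 hp' hr'
  have hη1 : 1 ≤ η := (le_max_left _ _).trans hη
  have hη2 : C * M * (1 + K2 * Real.pi) ≤ η :=
    ((le_max_left _ _).trans (le_max_right _ _)).trans hη
  have hη3 : 10 * M * (1 / t + K2) ≤ η := ((le_max_right _ _).trans (le_max_right _ _)).trans hη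
  have hη0 : 0 < η := by linarith
  have hsum : ∀ s ∈ Icc (0 : ℝ) Real.pi, p s + r s ≤ K1 := by
    intro s hs
    refine (add_le_of_abs_deriv_le hη0.le hp hr hr0 hp' hr' hs).trans ?_
    rw [hpi0, hri0, one_add_one_eq_two, hK1]
    gcongr
    exact hs.2
  have hrK : ∀ s ∈ Icc (0 : ℝ) Real.pi, r' s + 4 * η * r s ≤ K2 := by
    intro s hs
    refine (le_abs_self _).trans ((hr' s hs).trans ?_)
    rw [hK2, mul_comm 3 C, mul_assoc]
    gcongr
    linarith [hsum s hs, hp0 s]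
  have hrt := le_exp_add_of_deriv_le hη0 hK2p hr hrK ht
  have hd : ∀ s ∈ Icc (0 : ℝ) Real.pi, HasDerivWithinAt
      (fun s => Real.exp (3 * C * s) * p s + C * M / (4 * η) * (K2 * s - r s))
      (Real.exp (3 * C * s) * (3 * C * p s + p' s) + C * M / (4 * η) * (K2 - r' s))
      (Icc 0 Real.pi) s := by
    intro s hs
    have h1 : HasDerivWithinAt (fun s : ℝ => Real.exp (3 * C * s))
        (Real.exp (3 * C * s) * (3 * C)) (Icc 0 Real.pi) s := by
      simpa using (((hasDerivAt_id s).const_mul (3 * C)).exp).hasDerivWithinAt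
    have h2 : HasDerivWithinAt (fun s : ℝ => K2 * s) K2 (Icc 0 Real.pi) s := by
      simpa using ((hasDerivAt_id s).const_mul K2).hasDerivWithinAt
    convert! (h1.mul (hp s hs)).add ((h2.sub (hr s hs)).const_mul (C * M / (4 * η))) using 1
    ring
  have hmono := monotoneOn_of_hasDerivWithinAt_nonneg (convex_Icc 0 Real.pi)
    (fun s hs => (hd s hs).continuousWithinAt)
    (fun s hs => (hd s (interior_subset hs)).mono interior_subset) fun s hs => by
      have hs' : s ∈ Icc (0 : ℝ) Real.pi := interior_subset hs
      have h1 := (abs_le.1 (hp' s hs')).1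
      have h2 := hrK s hs'
      have hexp : Real.exp (3 * C * s) ≤ M := by
        rw [hM]
        gcongr
        exact hs'.2
      have h3 : Real.exp (3 * C * s) * (-(C * r s)) ≤ Real.exp (3 * C * s) * (3 * C * p s + p' s) :=
        by gcongr; linarith
      have h4 : Real.exp (3 * C * s) * (C * r s) ≤ M * (C * r s) := by
        gcongr
        exact mul_nonneg hC (hr0 s)
      have h5 : C * M / (4 * η) * (4 * η * r s) ≤ C * M / (4 * η) * (K2 - r' s) := by
        gcongr
        linarith
      have h6 : C * M / (4 * η) * (4 * η * r s) = M * (C * r s) := by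
        field_simp
      linarith
  have hm := hmono zero_mem_Icc_pi ht ht0.le
  simp only [mul_zero, Real.exp_zero, hpi0, hri0] at hm
  have hCM : C * M / (4 * η) * (1 + K2 * Real.pi) ≤ 1 / 4 := by
    rw [div_mul_eq_mul_div, div_le_iff₀ (by positivity)]
    linarith
  have hCM0 : 0 ≤ C * M / (4 * η) := by positivity
  have hpG : 1 / 2 ≤ Real.exp (3 * C * t) * p t := by
    have h1 : C * M / (4 * η) * (K2 * t - r t) ≤ C * M / (4 * η) * (K2 * Real.pi) := by
      gcongr
      have : K2 * t ≤ K2 * Real.pi := by gcongr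
      linarith [hr0 t]
    linarith
  have hpt : 1 / (2 * M) ≤ p t := by
    rw [div_le_iff₀ (by positivity)]
    have : Real.exp (3 * C * t) * p t ≤ M * p t := by
      rw [hM]
      gcongr
      exact hp0 t
    linarith
  refine ⟨hsum t ht, hpt, ?_⟩
  have hexp : Real.exp (-(4 * η * t)) ≤ 1 / (4 * η * t) := by
    rw [Real.exp_neg, ← one_div]
    gcongr
    linarith [Real.add_one_le_exp (4 * η * t)]
  have h1 : 20 * (1 / (4 * η * t) + K2 / (4 * η)) ≤ 1 / (2 * M) := by
    have e : 20 * (1 / (4 * η * t) + K2 / (4 * η)) = 5 * (1 / t + K2) / η := by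
      field_simp
      ring
    rw [e, div_le_div_iff₀ hη0 (by positivity)]
    linarith
  rw [hri0, one_mul] at hrt
  linarith

end Oscillation

section Asymptotics

variable {σ : ℝ → ℝ} {η t : ℝ}

/-- The square root `η (1 + i)` of the spectral parameter `2 i η²`. -/
def diagRoot (η : ℝ) : ℂ := η * (1 + Complex.I)

theorem diagRoot_sq (η : ℝ) : diagRoot η ^ 2 = 2 * (η : ℂ) ^ 2 * Complex.I := by
  unfold diagRoot
  linear_combination (η : ℂ) ^ 2 * Complex.I_sq

theorem normSq_diagRoot (η : ℝ) : ‖diagRoot η‖ ^ 2 = 2 * η ^ 2 := by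
  rw [Complex.sq_norm, Complex.normSq_apply]
  simp [diagRoot]
  ring

theorem norm_exp_diagRoot (η s : ℝ) :
    ‖Complex.exp (Complex.I * diagRoot η * s)‖ = Real.exp (-(η * s)) := by
  rw [Complex.norm_exp]
  simp [diagRoot]

theorem two_mul_norm_mul_le {S a : ℝ} {s : ℝ} {α β X : ℂ} (hs : |s| ≤ S) (ha : ‖α‖ = a)
    (hX : ‖X‖ ≤ (‖α‖ + ‖β‖) / 2) :
    2 * (a * ‖-(s * β) - s ^ 2 * X‖) ≤ (S + S ^ 2) * (3 * ‖α‖ ^ 2 + ‖β‖ ^ 2) := by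
  subst ha
  have h1 : ‖-(s * β) - s ^ 2 * X‖ ≤ S * ‖β‖ + S ^ 2 * ((‖α‖ + ‖β‖) / 2) := by
    refine (norm_sub_le _ _).trans ?_
    rw [norm_neg, norm_mul, norm_mul, norm_pow, Complex.norm_real, Real.norm_eq_abs]
    gcongr
  have hS : 0 ≤ S := (abs_nonneg s).trans hs
  have h2 := mul_le_mul_of_nonneg_left h1 (norm_nonneg α)
  nlinarith [mul_nonneg hS (sq_nonneg (‖α‖ - ‖β‖)), mul_nonneg (sq_nonneg S) (sq_nonneg (‖α‖ - ‖β‖)),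
    mul_nonneg hS (sq_nonneg ‖α‖), mul_nonneg (sq_nonneg S) (sq_nonneg ‖α‖),
    mul_nonneg (sq_nonneg S) (sq_nonneg ‖β‖)]

theorem diag_flux_identity (η : ℝ) (y w : ℂ) :
    8 * η * -(w * starRingEnd ℂ y).im =
      ‖w - Complex.I * diagRoot η * y‖ ^ 2 - ‖w + Complex.I * diagRoot η * y‖ ^ 2 +
        2 * ((w - Complex.I * diagRoot η * y) *
          starRingEnd ℂ (w + Complex.I * diagRoot η * y)).im := by
  simp only [Complex.sq_norm, Complex.normSq_apply, diagRoot]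
  simp
  ring

theorem hasDerivWithinAt_amplitudes {y w : ℝ → ℂ} (h : IsSys σ (diagRoot η ^ 2) y w) {s : ℝ}
    (hs : s ∈ Icc (0 : ℝ) Real.pi) :
    HasDerivWithinAt
      (fun s : ℝ => Complex.exp (Complex.I * diagRoot η * s) * (w s - Complex.I * diagRoot η * y s))
      (-(σ s * (Complex.exp (Complex.I * diagRoot η * s) * (w s + Complex.I * diagRoot η * y s))) -
        σ s ^ 2 * (Complex.exp (Complex.I * diagRoot η * s) * y s)) (Icc 0 Real.pi) s ∧
    HasDerivWithinAt
      (fun s : ℝ => Complex.exp (Complex.I * diagRoot η * s) * (w s + Complex.I * diagRoot η * y s))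
      (2 * Complex.I * diagRoot η *
          (Complex.exp (Complex.I * diagRoot η * s) * (w s + Complex.I * diagRoot η * y s)) +
        (-(σ s * (Complex.exp (Complex.I * diagRoot η * s) *
          (w s - Complex.I * diagRoot η * y s))) -
        σ s ^ 2 * (Complex.exp (Complex.I * diagRoot η * s) * y s))) (Icc 0 Real.pi) s := by
  obtain ⟨h1, h2⟩ := h s hs
  have hE : HasDerivWithinAt (fun s : ℝ => Complex.exp (Complex.I * diagRoot η * s))
      (Complex.exp (Complex.I * diagRoot η * s) * (Complex.I * diagRoot η)) (Icc 0 Real.pi) s := by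
    have := ((Complex.ofRealCLM.hasDerivAt (x := s)).const_mul (Complex.I * diagRoot η)).cexp
    simpa using this.hasDerivWithinAt
  constructor
  · convert! hE.mul (h2.sub (h1.const_mul (Complex.I * diagRoot η))) using 1
    simp only [Pi.sub_apply]
    linear_combination (diagRoot η ^ 2 * Complex.exp (Complex.I * diagRoot η * s) * y s) *
      Complex.I_sq
  · convert! hE.mul (h2.add (h1.const_mul (Complex.I * diagRoot η))) using 1
    simp only [Pi.add_apply]
    linear_combination (diagRoot η ^ 2 * Complex.exp (Complex.I * diagRoot η * s) * y s) *
      Complex.I_sq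

theorem norm_mul_le_of_diag (hη : 1 ≤ η) (e y w : ℂ) :
    ‖e * y‖ ≤ (‖e * (w - Complex.I * diagRoot η * y)‖ + ‖e * (w + Complex.I * diagRoot η * y)‖) / 2 ∧
    8 * η ^ 2 * ‖e * y‖ ^ 2 ≤ 2 * (‖e * (w - Complex.I * diagRoot η * y)‖ ^ 2 +
      ‖e * (w + Complex.I * diagRoot η * y)‖ ^ 2) := by
  have h1 : 2 * ‖diagRoot η‖ * ‖e * y‖ ≤
      ‖e * (w - Complex.I * diagRoot η * y)‖ + ‖e * (w + Complex.I * diagRoot η * y)‖ := by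
    have h2 : 2 * Complex.I * diagRoot η * (e * y) = e * (w + Complex.I * diagRoot η * y) -
        e * (w - Complex.I * diagRoot η * y) := by ring
    have h3 := norm_sub_le (e * (w + Complex.I * diagRoot η * y))
      (e * (w - Complex.I * diagRoot η * y))
    rw [← h2, norm_mul, norm_mul, norm_mul, Complex.norm_two, Complex.norm_I] at h3
    linarith
  have h4 := normSq_diagRoot η
  have h0 := norm_nonneg (diagRoot η)
  have h5 : 1 ≤ ‖diagRoot η‖ := by nlinarith
  have h6 := norm_nonneg (e * y)
  constructor
  · nlinarith
  · have h7 : (2 * ‖diagRoot η‖ * ‖e * y‖) ^ 2 = 8 * η ^ 2 * ‖e * y‖ ^ 2 := by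
      rw [mul_pow, mul_pow, h4]
      ring
    rw [← h7]
    exact (pow_le_pow_left₀ (by positivity) h1 2).trans add_sq_le

/-- Growth of the sine-type solution along the positive imaginary axis. -/
theorem Fund.exists_θ_bounds (hσ : ContinuousOn σ (Icc 0 Real.pi)) (F : Fund σ) (ht0 : 0 < t)
    (ht1 : t ≤ Real.pi) :
    ∃ η₀ K c : ℝ, 1 ≤ η₀ ∧ 0 < c ∧ ∀ η : ℝ, η₀ ≤ η →
      ‖F.θ t (diagRoot η ^ 2)‖ ^ 2 ≤ K * Real.exp (2 * (η * t)) / η ^ 2 ∧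
      c * Real.exp (2 * (η * t)) / η ≤
        -(F.θw t (diagRoot η ^ 2) * starRingEnd ℂ (F.θ t (diagRoot η ^ 2))).im := by
  have ht : t ∈ Icc (0 : ℝ) Real.pi := ⟨ht0.le, ht1⟩
  obtain ⟨S, hS⟩ := isCompact_Icc.exists_bound_of_continuousOn hσ
  simp only [Real.norm_eq_abs] at hS
  have hS0 : 0 ≤ S := (abs_nonneg _).trans (hS 0 zero_mem_Icc_pi)
  obtain ⟨η₀, K, c, hη₀, hc, H⟩ := exists_oscillation_bounds (C := S + S ^ 2) (by positivity) ht0 ht1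
  refine ⟨η₀, K / 4, c / 16, hη₀, by positivity, fun η hη => ?_⟩
  have hη1 : 1 ≤ η := hη₀.trans hη
  have hsys := F.sysθ (diagRoot η ^ 2)
  set y : ℝ → ℂ := fun t => F.θ t (diagRoot η ^ 2) with hy
  set w : ℝ → ℂ := fun t => F.θw t (diagRoot η ^ 2) with hw
  have hX := fun s : ℝ =>
    norm_mul_le_of_diag hη1 (Complex.exp (Complex.I * diagRoot η * s)) (y s) (w s)
  have hy0 : y 0 = 0 := F.θ_zero _
  have hw0 : w 0 = 1 := F.θw_zero _
  have key := H η hη _ _ _ _ (fun s hs => (hasDerivWithinAt_amplitudes hsys hs).1.norm_sq)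
    (fun s hs => (hasDerivWithinAt_amplitudes hsys hs).2.norm_sq)
    (fun s => sq_nonneg _) (fun s => sq_nonneg _) (by simp [hy0, hw0]) (by simp [hy0, hw0])
    (fun s hs => by
      refine le_trans ?_ (two_mul_norm_mul_le (hS s hs) rfl (hX s).1)
      rw [abs_mul, abs_two]
      gcongr
      exact abs_real_inner_le_norm _ _)
    (fun s hs => by
      have hre : ∀ β g : ℂ, 2 * inner ℝ β (2 * Complex.I * diagRoot η * β + g) +
          4 * η * ‖β‖ ^ 2 = 2 * inner ℝ β g := by
        intro β g
        simp only [Complex.inner, Complex.sq_norm, Complex.normSq_apply, diagRoot]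
        simp
        ring
      rw [hre, add_comm (‖_‖ ^ 2)]
      refine le_trans ?_ (two_mul_norm_mul_le (hS s hs) rfl ((hX s).1.trans_eq (by rw [add_comm])))
      rw [abs_mul, abs_two]
      gcongr
      exact abs_real_inner_le_norm _ _)
  obtain ⟨k1, k2, k3⟩ := key
  have hX2 := (hX t).2
  have hflux := diag_flux_identity η (y t) (w t)
  have him := (neg_le_abs _).trans (Complex.abs_im_le_norm
    ((w t - Complex.I * diagRoot η * y t) *
          starRingEnd ℂ (w t + Complex.I * diagRoot η * y t)))
  rw [norm_mul, Complex.norm_conj] at him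
  simp only [norm_mul _ (w t - _), norm_mul _ (w t + _), norm_mul _ (y t), norm_exp_diagRoot,
    mul_pow] at k1 k2 k3 hX2
  have hη0 : 0 < η := by linarith
  have hee : Real.exp (-(η * t)) ^ 2 * Real.exp (2 * (η * t)) = 1 := by
    rw [← Real.exp_nat_mul, ← Real.exp_add]
    simp
  have hpos := Real.exp_pos (2 * (η * t))
  set e := Real.exp (2 * (η * t))
  set d := Real.exp (-(η * t)) ^ 2
  set a := ‖w t - Complex.I * diagRoot η * y t‖
  set b := ‖w t + Complex.I * diagRoot η * y t‖
  constructor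
  · rw [le_div_iff₀ (by positivity)]
    have : 8 * η ^ 2 * ‖y t‖ ^ 2 ≤ 2 * K * e := by
      calc 8 * η ^ 2 * ‖y t‖ ^ 2 = 8 * η ^ 2 * (d * ‖y t‖ ^ 2) * e := by
            linear_combination (-(8 * η ^ 2 * ‖y t‖ ^ 2)) * hee
        _ ≤ 2 * K * e := mul_le_mul_of_nonneg_right (by linarith) hpos.le
    linarith
  · rw [div_le_iff₀ hη0]
    have h1 : c * e ≤ a ^ 2 := by
      calc c * e ≤ d * a ^ 2 * e := by gcongr
        _ = a ^ 2 := by linear_combination a ^ 2 * hee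
    have h2 : 20 * b ^ 2 ≤ a ^ 2 := by
      calc 20 * b ^ 2 = 20 * (d * b ^ 2) * e := by linear_combination (-(20 * b ^ 2)) * hee
        _ ≤ d * a ^ 2 * e := by gcongr
        _ = a ^ 2 := by linear_combination a ^ 2 * hee
    nlinarith [sq_nonneg (a - 4 * b)]

end Asymptotics

section Uniqueness

theorem IsSys.antitoneOn_flux {σ : ℝ → ℝ} {z : ℂ} {y w : ℝ → ℂ} (h : IsSys σ z y w)
    (hz : 0 ≤ z.im) :
    AntitoneOn (fun t => (w t * starRingEnd ℂ (y t)).im) (Icc 0 Real.pi) := by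
  have hd : ∀ t ∈ Icc (0 : ℝ) Real.pi, HasDerivWithinAt (fun t => (w t * starRingEnd ℂ (y t)).im)
      (-(z.im * ‖y t‖ ^ 2)) (Icc 0 Real.pi) t := by
    intro t ht
    obtain ⟨h1, h2⟩ := h t ht
    have h3 : HasDerivWithinAt (fun t => starRingEnd ℂ (y t)) _ (Icc 0 Real.pi) t := h1.star
    have h4 := (Complex.imCLM.hasFDerivAt.comp_hasDerivWithinAt t (h2.mul h3))
    convert! h4 using 1
    simp only [Complex.sq_norm, Complex.normSq_apply, Complex.imCLM_apply]
    simp [pow_two]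
    ring
  exact antitoneOn_of_hasDerivWithinAt_nonpos (convex_Icc 0 Real.pi)
    (fun s hs => (hd s hs).continuousWithinAt)
    (fun s hs => (hd s (interior_subset hs)).mono interior_subset) fun s _ =>
      neg_nonpos.2 (mul_nonneg hz (sq_nonneg _))

theorem IsSys.norm_fst_le {σ : ℝ → ℝ} {z : ℂ} {y w : ℝ → ℂ} (h : IsSys σ z y w) {S r t : ℝ}
    (hS : ∀ t ∈ Icc (0 : ℝ) Real.pi, |σ t| ≤ S) (hr : 0 ≤ r) (hz : ‖z‖ ≤ r ^ 2)
    (hy : ‖y 0‖ ≤ 1) (hw : ‖w 0‖ ≤ 1) (ht : t ∈ Icc (0 : ℝ) Real.pi) :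
    ‖y t‖ ≤ Real.exp ((S + 1 + S ^ 2) * Real.pi + Real.pi * r) := by
  have hS0 : 0 ≤ S := (abs_nonneg _).trans (hS 0 zero_mem_Icc_pi)
  have h1 := (le_max_left _ _).trans (h.norm_le (κ := 1 + r) hS (by linarith)
    (hz.trans (by gcongr; linarith)) ht)
  have h2 : max ((1 + r) * ‖y 0‖) ‖w 0‖ ≤ (1 + r) * 1 :=
    max_le (by gcongr) (by linarith)
  have h3 : ‖y t‖ ≤ Real.exp ((S + (1 + r) + S ^ 2) * t) := by
    refine le_of_mul_le_mul_left (a := 1 + r) (h1.trans ?_) (by linarith)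
    gcongr
    linarith
  refine h3.trans (Real.exp_le_exp.2 ?_)
  calc (S + (1 + r) + S ^ 2) * t ≤ (S + (1 + r) + S ^ 2) * Real.pi := by
        gcongr
        exact ht.2
    _ = _ := by ring

/-- An entire function of exponential type, with equal moduli on the two coordinate axes and
decaying along the positive half-axis, vanishes identically. -/
theorem eq_zero_of_exp_growth {G : ℂ → ℂ} (hG : Differentiable ℂ G) {A B C η₀ : ℝ}
    (hgrowth : ∀ w, ‖G w‖ ≤ A * Real.exp (B * ‖w‖)) (hη₀ : 1 ≤ η₀)
    (hneg : ∀ w, G (-w) = G w) (hI : ∀ x : ℝ, ‖G (x * Complex.I)‖ = ‖G x‖)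
    (hdecay : ∀ x : ℝ, η₀ ≤ x → ‖G x‖ ≤ C / x) (w : ℂ) : G w = 0 := by
  obtain ⟨M, hM⟩ := (isCompact_Icc (a := (0 : ℝ)) (b := η₀)).exists_bound_of_continuousOn
    (f := fun x : ℝ => G x) (hG.continuous.comp Complex.continuous_ofReal).continuousOn
  have hC : 0 ≤ C := by
    have := (norm_nonneg _).trans (hdecay η₀ le_rfl)
    by_contra! hlt
    exact absurd this (not_le.2 (div_neg_of_neg_of_pos hlt (by linarith)))
  have hnonneg : ∀ x : ℝ, 0 ≤ x → ‖G x‖ ≤ max M C := by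
    intro x hx
    rcases le_total x η₀ with h | h
    · exact (hM x ⟨hx, h⟩).trans (le_max_left _ _)
    · exact (hdecay x h).trans ((div_le_self hC (hη₀.trans h)).trans (le_max_right _ _))
  have hreal : ∀ x : ℝ, ‖G x‖ ≤ max M C := by
    intro x
    rcases le_total 0 x with h | h
    · exact hnonneg x h
    · rw [← hneg, ← Complex.ofReal_neg]
      exact hnonneg _ (by linarith)
  have himag : ∀ x : ℝ, ‖G (x * Complex.I)‖ ≤ max M C := fun x => (hI x).trans_le (hreal x)
  have hO : ∀ s : Set ℂ, ∃ c < (2 : ℝ), ∃ B, G =O[Bornology.cobounded ℂ ⊓ Filter.principal s]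
      fun z => Real.exp (B * ‖z‖ ^ c) := fun s =>
    ⟨1, by norm_num, B, (Asymptotics.IsBigO.of_bound A (Filter.Eventually.of_forall fun z => by
      simpa [Real.norm_eq_abs, Real.abs_exp] using hgrowth z))⟩
  have hbound : ∀ z, ‖G z‖ ≤ max M C := by
    intro z
    rcases le_total 0 z.re with h1 | h1 <;> rcases le_total 0 z.im with h2 | h2
    · exact PhragmenLindelof.quadrant_I hG.diffContOnCl (hO _) (fun x _ => hreal x)
        (fun x _ => himag x) h1 h2
    · exact PhragmenLindelof.quadrant_IV hG.diffContOnCl (hO _) (fun x _ => hreal x)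
        (fun x _ => himag x) h1 h2
    · exact PhragmenLindelof.quadrant_II hG.diffContOnCl (hO _) (fun x _ => hreal x)
        (fun x _ => himag x) h1 h2
    · exact PhragmenLindelof.quadrant_III hG.diffContOnCl (hO _) (fun x _ => hreal x)
        (fun x _ => himag x) h1 h2
  have hconst := fun x : ℝ => hG.apply_eq_apply_of_bounded
    (isBounded_iff_forall_norm_le.2 ⟨max M C, by rintro _ ⟨z, rfl⟩; exact hbound z⟩) w x
  have hlim : ∀ᶠ x : ℝ in Filter.atTop, ‖G w‖ ≤ C / x := by
    filter_upwards [Filter.eventually_ge_atTop η₀] with x hx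
    rw [hconst x]
    exact hdecay x hx
  have := ge_of_tendsto (tendsto_const_nhds.div_atTop Filter.tendsto_id) hlim
  exact norm_le_zero_iff.1 this

variable {σ σ₁ σ₂ : ℝ → ℝ} {t : ℝ}

theorem Fund.R_ne_zero_and_norm_ψ_mul_le (F : Fund σ) (f : RatHN) {z : ℂ} (hz : 0 ≤ z.im)
    (ht : t ∈ Icc (0 : ℝ) Real.pi) {J : ℝ} (hJ : 0 < J)
    (hJθ : J ≤ -(F.θw t z * starRingEnd ℂ (F.θ t z)).im) :
    F.R f z ≠ 0 ∧ ‖F.ψ f t z‖ * J ≤ ‖F.R f z‖ * ‖F.θ t z‖ := by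
  have hflux : 0 ≤ (F.ψw f t z * starRingEnd ℂ (F.ψ f t z)).im := by
    refine le_trans ?_ ((F.sysψ f z).antitoneOn_flux hz ht pi_mem_Icc_pi ht.2)
    have h := f.im_num_mul_conj_den_nonneg hz
    simp only [F.ψ_pi, F.ψw_pi]
    have h2 : ((σ Real.pi * f.den z) * starRingEnd ℂ (f.den z)).im = 0 := by
      rw [mul_assoc, Complex.mul_conj, ← Complex.ofReal_mul, Complex.ofReal_im]
    rwa [sub_mul, Complex.sub_im, h2, sub_zero]
  have hw : F.ψ f t z * F.θw t z - F.ψw f t z * F.θ t z = F.R f z := by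
    have := F.wronskian z ht
    unfold Fund.ψ Fund.ψw
    linear_combination F.R f z * this
  have hle : ‖F.ψ f t z‖ * J ≤ ‖F.R f z‖ * ‖F.θ t z‖ := by
    rcases (norm_nonneg (F.ψ f t z)).eq_or_lt with h0 | h0
    · rw [← h0, zero_mul]
      positivity
    refine le_of_mul_le_mul_left ?_ h0
    have e : F.R f z * (starRingEnd ℂ (F.ψ f t z) * starRingEnd ℂ (F.θ t z)) =
        (‖F.ψ f t z‖ ^ 2 : ℝ) * (F.θw t z * starRingEnd ℂ (F.θ t z)) -
        (‖F.θ t z‖ ^ 2 : ℝ) * (F.ψw f t z * starRingEnd ℂ (F.ψ f t z)) := by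
      rw [Complex.sq_norm, Complex.sq_norm, ← Complex.mul_conj, ← Complex.mul_conj, ← hw]
      ring
    have h1 := (neg_le_abs _).trans (Complex.abs_im_le_norm
      (F.R f z * (starRingEnd ℂ (F.ψ f t z) * starRingEnd ℂ (F.θ t z))))
    rw [norm_mul, norm_mul, Complex.norm_conj, Complex.norm_conj, e, Complex.sub_im,
      Complex.im_ofReal_mul, Complex.im_ofReal_mul] at h1
    have h2 := mul_nonneg (sq_nonneg ‖F.θ t z‖) hflux
    have h3 := mul_le_mul_of_nonneg_left hJθ (sq_nonneg ‖F.ψ f t z‖)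
    nlinarith
  refine ⟨fun hR => ?_, hle⟩
  rw [hR, norm_zero, zero_mul] at hle
  have hψ : F.ψ f t z = 0 := norm_le_zero_iff.1 (by nlinarith [norm_nonneg (F.ψ f t z)])
  have hP := (F.P_ne_zero_or_R_ne_zero f z).resolve_right (not_not.2 hR)
  have hθ : F.θ t z = 0 := by
    simpa [Fund.ψ, hR, hP] using hψ
  rw [hθ, map_zero, mul_zero, Complex.zero_im] at hJθ
  linarith

theorem Fund.norm_cross_le (F₁ : Fund σ₁) (F₂ : Fund σ₂) (f₁ f₂ : RatHN) {z : ℂ}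
    (hPR : F₁.P f₁ z * F₂.R f₂ z = F₂.P f₂ z * F₁.R f₁ z) (hz : 0 ≤ z.im)
    (ht : t ∈ Icc (0 : ℝ) Real.pi) {J : ℝ} (hJ : 0 < J)
    (hJ₁ : J ≤ -(F₁.θw t z * starRingEnd ℂ (F₁.θ t z)).im)
    (hJ₂ : J ≤ -(F₂.θw t z * starRingEnd ℂ (F₂.θ t z)).im) :
    ‖F₁.φ t z * F₂.θ t z - F₂.φ t z * F₁.θ t z‖ ≤ 2 * (‖F₁.θ t z‖ * ‖F₂.θ t z‖) / J := by
  obtain ⟨hR₁, h₁⟩ := F₁.R_ne_zero_and_norm_ψ_mul_le f₁ hz ht hJ hJ₁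
  obtain ⟨hR₂, h₂⟩ := F₂.R_ne_zero_and_norm_ψ_mul_le f₂ hz ht hJ hJ₂
  have e : F₁.R f₁ z * F₂.R f₂ z * (F₁.φ t z * F₂.θ t z - F₂.φ t z * F₁.θ t z) =
      F₁.ψ f₁ t z * F₂.R f₂ z * F₂.θ t z - F₂.ψ f₂ t z * F₁.R f₁ z * F₁.θ t z := by
    unfold Fund.ψ
    linear_combination (F₁.θ t z * F₂.θ t z) * hPR
  rw [le_div_iff₀ hJ]
  have hpos : 0 < ‖F₁.R f₁ z‖ * ‖F₂.R f₂ z‖ := by positivity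
  refine le_of_mul_le_mul_left ?_ hpos
  have h3 := congrArg norm e
  rw [norm_mul, norm_mul] at h3
  have h4 := norm_sub_le (F₁.ψ f₁ t z * F₂.R f₂ z * F₂.θ t z)
    (F₂.ψ f₂ t z * F₁.R f₁ z * F₁.θ t z)
  rw [← h3, norm_mul, norm_mul, norm_mul, norm_mul] at h4
  have h5 := mul_le_mul_of_nonneg_right h₁ (by positivity : 0 ≤ ‖F₂.R f₂ z‖ * ‖F₂.θ t z‖)
  have h6 := mul_le_mul_of_nonneg_right h₂ (by positivity : 0 ≤ ‖F₁.R f₁ z‖ * ‖F₁.θ t z‖)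
  have h7 := mul_le_mul_of_nonneg_right h4 hJ.le
  linarith

theorem Fund.cross_eq_zero (hσ₁ : ContinuousOn σ₁ (Icc 0 Real.pi))
    (hσ₂ : ContinuousOn σ₂ (Icc 0 Real.pi)) (F₁ : Fund σ₁) (F₂ : Fund σ₂) (f₁ f₂ : RatHN)
    (hPR : ∀ z, F₁.P f₁ z * F₂.R f₂ z = F₂.P f₂ z * F₁.R f₁ z)
    (ht : t ∈ Icc (0 : ℝ) Real.pi) (z : ℂ) :
    F₁.φ t z * F₂.θ t z = F₂.φ t z * F₁.θ t z := by
  rcases ht.1.eq_or_lt with rfl | ht0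
  · rw [F₁.θ_zero, F₂.θ_zero, mul_zero, mul_zero]
  set D : ℂ → ℂ := fun z => F₁.φ t z * F₂.θ t z - F₂.φ t z * F₁.θ t z with hD
  have hDdiff : Differentiable ℂ D :=
    ((F₁.diffφ t).mul (F₂.diffθ t)).sub ((F₂.diffφ t).mul (F₁.diffθ t))
  have hDconj : ∀ z, D (starRingEnd ℂ z) = starRingEnd ℂ (D z) := by
    intro z
    simp [hD, (F₁.φ_conj hσ₁ z ht).1, (F₂.φ_conj hσ₂ z ht).1, (F₁.θ_conj hσ₁ z ht).1,
      (F₂.θ_conj hσ₂ z ht).1]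
  obtain ⟨S₁, hS₁⟩ := isCompact_Icc.exists_bound_of_continuousOn hσ₁
  obtain ⟨S₂, hS₂⟩ := isCompact_Icc.exists_bound_of_continuousOn hσ₂
  obtain ⟨η₁, K₁, c₁, hη₁, hc₁, H₁⟩ := F₁.exists_θ_bounds hσ₁ ht0 ht.2
  obtain ⟨η₂, K₂, c₂, hη₂, hc₂, H₂⟩ := F₂.exists_θ_bounds hσ₂ ht0 ht.2
  have hzero := eq_zero_of_exp_growth (G := fun w => D (2 * Complex.I * w ^ 2))
    (A := 2 * Real.exp ((S₁ + 1 + S₁ ^ 2) * Real.pi + (S₂ + 1 + S₂ ^ 2) * Real.pi))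
    (B := 2 * (Real.pi * 2)) (C := (K₁ + K₂) / min c₁ c₂) (η₀ := max η₁ η₂)
    (hDdiff.comp (by fun_prop)) ?_ (hη₁.trans (le_max_left _ _)) ?_ ?_ ?_
  · obtain ⟨v, hv⟩ := IsAlgClosed.exists_pow_nat_eq (z / (2 * Complex.I)) (n := 2) (by norm_num)
    have := hzero v
    rw [hv, mul_div_cancel₀ _ (by simp)] at this
    exact sub_eq_zero.1 this
  · intro w
    have hr : ‖2 * Complex.I * w ^ 2‖ ≤ (2 * ‖w‖) ^ 2 := by
      simp only [norm_mul, norm_pow, Complex.norm_two, Complex.norm_I]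
      nlinarith [sq_nonneg ‖w‖]
    have hr0 : 0 ≤ 2 * ‖w‖ := by positivity
    set v := 2 * Complex.I * w ^ 2
    have a1 := (F₁.sysφ v).norm_fst_le hS₁ hr0 hr (by simp [F₁.φ_zero]) (by simp [F₁.φw_zero]) ht
    have a2 := (F₂.sysφ v).norm_fst_le hS₂ hr0 hr (by simp [F₂.φ_zero]) (by simp [F₂.φw_zero]) ht
    have a3 := (F₁.sysθ v).norm_fst_le hS₁ hr0 hr (by simp [F₁.θ_zero]) (by simp [F₁.θw_zero]) ht
    have a4 := (F₂.sysθ v).norm_fst_le hS₂ hr0 hr (by simp [F₂.θ_zero]) (by simp [F₂.θw_zero]) ht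
    refine (norm_sub_le _ _).trans ?_
    rw [norm_mul, norm_mul]
    have b1 := mul_le_mul a1 a4 (norm_nonneg _) (Real.exp_pos _).le
    have b2 := mul_le_mul a2 a3 (norm_nonneg _) (Real.exp_pos _).le
    rw [← Real.exp_add] at b1 b2
    rw [mul_assoc, ← Real.exp_add]
    ring_nf at b1 b2 ⊢
    linarith
  · intro w
    simp
  · intro x
    have : 2 * Complex.I * (x * Complex.I) ^ 2 = starRingEnd ℂ (2 * Complex.I * (x : ℂ) ^ 2) := by
      have h2 : starRingEnd ℂ 2 = 2 := map_ofNat _ 2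
      simp [mul_pow, h2]
    simp only [this, hDconj, Complex.norm_conj]
  · intro x hx
    have hx0 : 0 < x := lt_of_lt_of_le (by linarith [le_max_left η₁ η₂]) hx
    obtain ⟨u₁, v₁⟩ := H₁ x ((le_max_left _ _).trans hx)
    obtain ⟨u₂, v₂⟩ := H₂ x ((le_max_right _ _).trans hx)
    have hz : diagRoot x ^ 2 = 2 * Complex.I * (x : ℂ) ^ 2 := by
      rw [diagRoot_sq]
      ring
    rw [hz] at u₁ v₁ u₂ v₂
    have him : 0 ≤ (2 * Complex.I * (x : ℂ) ^ 2).im := by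
      have : 2 * Complex.I * (x : ℂ) ^ 2 = (2 * x ^ 2 : ℝ) * Complex.I := by
        push_cast
        ring
      rw [this, Complex.im_ofReal_mul, Complex.I_im, mul_one]
      positivity
    set e := Real.exp (2 * (x * t)) with he
    have hepos : 0 < e := Real.exp_pos _
    have hcmin : 0 < min c₁ c₂ := lt_min hc₁ hc₂
    have hle := Fund.norm_cross_le F₁ F₂ f₁ f₂ (hPR (2 * Complex.I * (x : ℂ) ^ 2)) him ht
      (J := min c₁ c₂ * e / x) (by positivity)
      (le_trans (by gcongr; exact min_le_left _ _) v₁)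
      (le_trans (by gcongr; exact min_le_right _ _) v₂)
    refine hle.trans ?_
    rw [div_le_iff₀ (by positivity)]
    have h8 : (K₁ + K₂) / min c₁ c₂ / x * (min c₁ c₂ * e / x) = K₁ * e / x ^ 2 + K₂ * e / x ^ 2 := by
      field_simp
    rw [h8]
    linarith [two_mul_le_add_sq ‖F₁.θ t (2 * Complex.I * (x : ℂ) ^ 2)‖
      ‖F₂.θ t (2 * Complex.I * (x : ℂ) ^ 2)‖]

end Uniqueness

section Recovery

variable {σ₁ σ₂ : ℝ → ℝ}

/-- A very negative spectral parameter at which `φ` has no zero. -/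
theorem Fund.φ_ne_zero {σ : ℝ → ℝ} (F : Fund σ) {S lam : ℝ}
    (hS : ∀ t ∈ Icc (0 : ℝ) Real.pi, |σ t| ≤ S) (hlam : (S + 3) ^ 2 + 1 ≤ -lam) {t : ℝ}
    (ht : t ∈ Icc (0 : ℝ) Real.pi) : F.φ t lam ≠ 0 := by
  intro h0
  have := (F.sysφ lam).re.barrier (L := 1) (B := 0) hS zero_le_one zero_lt_one (by linarith)
    (by simp [F.φ_zero]) (by simp [F.φw_zero]) ht
  simp [h0] at this

theorem Fund.hasDerivWithinAt_ratio {σ : ℝ → ℝ} (F : Fund σ) {z : ℂ} {t : ℝ}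
    (ht : t ∈ Icc (0 : ℝ) Real.pi) (hne : F.φ t z ≠ 0) :
    HasDerivWithinAt (fun t => F.θ t z / F.φ t z) (1 / F.φ t z ^ 2) (Icc 0 Real.pi) t := by
  convert! (F.sysθ z t ht).1.div (F.sysφ z t ht).1 hne using 1
  congr 1
  linear_combination -(F.wronskian z ht)

theorem Fund.eqOn_φ (F₁ : Fund σ₁) (F₂ : Fund σ₂) {z : ℂ}
    (h₁ : ∀ t ∈ Icc (0 : ℝ) Real.pi, F₁.φ t z ≠ 0) (h₂ : ∀ t ∈ Icc (0 : ℝ) Real.pi, F₂.φ t z ≠ 0)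
    (h : ∀ t ∈ Icc (0 : ℝ) Real.pi, F₁.φ t z * F₂.θ t z = F₂.φ t z * F₁.θ t z) :
    EqOn (fun t => F₁.φ t z) (fun t => F₂.φ t z) (Icc 0 Real.pi) := by
  refine isPreconnected_Icc.eq_of_sq_eq (F₁.sysφ z).continuousOn_fst (F₂.sysφ z).continuousOn_fst
    (fun t ht => ?_) (fun {t} ht => h₂ t ht) zero_mem_Icc_pi (by simp only [F₁.φ_zero, F₂.φ_zero])
  have hr : ∀ s ∈ Icc (0 : ℝ) Real.pi, F₁.θ s z / F₁.φ s z = F₂.θ s z / F₂.φ s z := fun s hs => by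
    rw [div_eq_div_iff (h₁ s hs) (h₂ s hs)]
    linear_combination -(h s hs)
  have hd₁ := F₁.hasDerivWithinAt_ratio ht (h₁ t ht)
  have hd₂ := (F₂.hasDerivWithinAt_ratio ht (h₂ t ht)).congr_of_mem hr ht
  have := (uniqueDiffOn_Icc Real.pi_pos t ht).eq_deriv _ hd₁ hd₂
  rw [one_div, one_div, inv_inj] at this
  exact this

theorem Fund.eqOn_sigma (F₁ : Fund σ₁) (F₂ : Fund σ₂) {z : ℂ}
    (h₁ : ∀ t ∈ Icc (0 : ℝ) Real.pi, F₁.φ t z ≠ 0) (h₂ : ∀ t ∈ Icc (0 : ℝ) Real.pi, F₂.φ t z ≠ 0)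
    (h : ∀ t ∈ Icc (0 : ℝ) Real.pi, F₁.φ t z * F₂.θ t z = F₂.φ t z * F₁.θ t z) :
    EqOn σ₁ σ₂ (Icc 0 Real.pi) := by
  have hφ := F₁.eqOn_φ F₂ h₁ h₂ h
  simp only [EqOn] at hφ
  have hw : ∀ t ∈ Icc (0 : ℝ) Real.pi,
      F₂.φw t z - F₁.φw t z = (σ₁ t - σ₂ t) * F₁.φ t z := fun t ht => by
    have := (uniqueDiffOn_Icc Real.pi_pos t ht).eq_deriv _ (F₁.sysφ z t ht).1
      ((F₂.sysφ z t ht).1.congr_of_mem hφ ht)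
    simp only [← hφ ht] at this
    linear_combination -this
  have hd : ∀ t ∈ Icc (0 : ℝ) Real.pi,
      HasDerivWithinAt (fun t => (F₂.φw t z - F₁.φw t z) / F₁.φ t z) 0 (Icc 0 Real.pi) t := by
    intro t ht
    convert! ((F₂.sysφ z t ht).2.sub (F₁.sysφ z t ht).2).div (F₁.sysφ z t ht).1 (h₁ t ht) using 1
    rw [eq_comm, div_eq_zero_iff]
    left
    simp only [Pi.sub_apply, ← hφ ht]
    linear_combination (-(σ₁ t + σ₂ t) * F₁.φ t z - F₁.φw t z) * hw t ht
  intro t ht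
  have hc := constant_of_derivWithin_zero (fun s hs => (hd s hs).differentiableWithinAt)
    (fun s hs => (hd s (Ico_subset_Icc_self hs)).derivWithin
      (uniqueDiffOn_Icc Real.pi_pos s (Ico_subset_Icc_self hs))) t ht
  simp only [hw t ht, F₁.φw_zero, F₂.φw_zero, sub_self, zero_div,
    mul_div_cancel_right₀ _ (h₁ t ht)] at hc
  exact_mod_cast sub_eq_zero.1 hc

theorem RatHN.eq_of_cross_mul_eq (hσ₁ : ContinuousOn σ₁ (Icc 0 Real.pi))
    (hσ : EqOn σ₁ σ₂ (Icc 0 Real.pi)) (F₁ : Fund σ₁) (F₂ : Fund σ₂) {f₁ f₂ : RatHN}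
    (h : ∀ z, F₁.P f₁ z * F₂.R f₂ z = F₂.P f₂ z * F₁.R f₁ z) : f₁ = f₂ := by
  refine RatHN.eq_of_cross_mul fun z => ?_
  have h1 := (F₁.sysφ z).unique hσ₁ ((F₂.sysφ z).congr_sigma hσ.symm)
    (by simp only [F₁.φ_zero, F₂.φ_zero]) (by simp only [F₁.φw_zero, F₂.φw_zero]) pi_mem_Icc_pi
  have h2 := (F₁.sysθ z).unique hσ₁ ((F₂.sysθ z).congr_sigma hσ.symm)
    (by simp only [F₁.θ_zero, F₂.θ_zero]) (by simp only [F₁.θw_zero, F₂.θw_zero]) pi_mem_Icc_pi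
  have h3 := h z
  have h4 := F₁.wronskian z pi_mem_Icc_pi
  unfold Fund.P Fund.R at h3
  rw [← h1.1, ← h1.2, ← h2.1, ← h2.2, ← hσ pi_mem_Icc_pi] at h3
  linear_combination h3 - (f₁.den z * f₂.num z - f₂.den z * f₁.num z) * h4

theorem ae_eq_of_primitive_reflect_eq {q₁ q₂ : ℝ → ℝ} (hq₁ : IntervalIntegrable q₁ volume 0 Real.pi)
    (hq₂ : IntervalIntegrable q₂ volume 0 Real.pi)
    (h : EqOn (fun x => ∫ t in (0 : ℝ)..x, q₁ (Real.pi - t))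
      (fun x => ∫ t in (0 : ℝ)..x, q₂ (Real.pi - t)) (Icc 0 Real.pi)) :
    ∀ᵐ x : ℝ ∂volume, x ∈ Ioo 0 Real.pi → q₁ x = q₂ x := by
  filter_upwards [hq₁.ae_hasDerivAt_integral, hq₂.ae_hasDerivAt_integral] with x h₁ h₂ hx
  have hx' : x ∈ uIcc 0 Real.pi := by
    rw [uIcc_of_le Real.pi_pos.le]
    exact Ioo_subset_Icc_self hx
  refine (h₁ hx' Real.pi right_mem_uIcc).unique
    ((h₂ hx' Real.pi right_mem_uIcc).congr_of_eventuallyEq ?_)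
  filter_upwards [Ioo_mem_nhds hx.1 hx.2] with s hs
  have := h (x := Real.pi - s) ⟨by linarith [hs.2], by linarith [hs.1]⟩
  simp only [intervalIntegral.integral_comp_sub_left, sub_zero, sub_sub_cancel] at this
  rw [intervalIntegral.integral_symm, this, ← intervalIntegral.integral_symm]

end Recovery

theorem mclaughlin_rundell_lowest_index
    (q₁ q₂ : ℝ → ℝ)
    (hq₁ : IntegrableOn q₁ (Ioo 0 Real.pi))
    (hq₂ : IntegrableOn q₂ (Ioo 0 Real.pi))
    (f₁ f₂ : RatHN)
    (b : ℕ → ℝ) (hb : Function.Injective b) (hbdd : BddAbove (Set.range b))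
    (h : ∀ j : ℕ, ∃ Λ₁ Λ₂ : ℕ → ℝ,
      IsEnum (eigenvalues q₁ f₁ (some (b j))) Λ₁ ∧
      IsEnum (eigenvalues q₂ f₂ (some (b j))) Λ₂ ∧
      Λ₁ 0 = Λ₂ 0) :
    (∀ᵐ x : ℝ ∂volume, x ∈ Ioo 0 Real.pi → q₁ x = q₂ x) ∧ f₁ = f₂ := by
  have hint : ∀ {q : ℝ → ℝ}, IntegrableOn q (Ioo 0 Real.pi) →
      IntervalIntegrable q volume 0 Real.pi := fun hq =>
    (intervalIntegrable_iff_integrableOn_Ioo_of_le Real.pi_pos.le).2 hq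
  have hσ₁ := continuousOn_primitive_pi (intervalIntegrable_reflect (hint hq₁))
  have hσ₂ := continuousOn_primitive_pi (intervalIntegrable_reflect (hint hq₂))
  obtain ⟨F₁⟩ := Fund.nonempty hσ₁
  obtain ⟨F₂⟩ := Fund.nonempty hσ₂
  have hPR := cross_mul_eq hσ₁ F₁ F₂ f₁ f₂ hb hbdd fun j => by
    obtain ⟨Λ₁, Λ₂, h1, h2, h0⟩ := h j
    have hset : eigenvalues q₁ f₁ (some (b j)) = {x : ℝ | F₁.P f₁ x - b j * F₁.R f₁ x = 0} :=
      Set.ext fun x => isEigen_iff (hint hq₁) f₁ F₁ (b j) x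
    have hmem : Λ₂ 0 ∈ eigenvalues q₂ f₂ (some (b j)) := h2.2 ▸ mem_range_self 0
    exact ⟨Λ₁, hset ▸ h1, h0 ▸ (isEigen_iff (hint hq₂) f₂ F₂ (b j) _).1 hmem⟩
  obtain ⟨S₁, hS₁⟩ := isCompact_Icc.exists_bound_of_continuousOn hσ₁
  obtain ⟨S₂, hS₂⟩ := isCompact_Icc.exists_bound_of_continuousOn hσ₂
  have hlam : (max S₁ S₂ + 3) ^ 2 + 1 ≤ -(-((max S₁ S₂ + 3) ^ 2 + 1)) := (neg_neg _).ge
  have hσ := F₁.eqOn_sigma F₂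
    (fun t ht => F₁.φ_ne_zero (fun s hs => (hS₁ s hs).trans (le_max_left _ _)) hlam ht)
    (fun t ht => F₂.φ_ne_zero (fun s hs => (hS₂ s hs).trans (le_max_right _ _)) hlam ht)
    fun t ht => Fund.cross_eq_zero hσ₁ hσ₂ F₁ F₂ f₁ f₂ hPR ht _
  exact ⟨ae_eq_of_primitive_reflect_eq (hint hq₁) (hint hq₂) hσ,
    RatHN.eq_of_cross_mul_eq hσ₁ hσ F₁ F₂ hPR⟩
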